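/- arXiv:1504.02987 — 10 statements merged into one kernel-verified Lean document; each statement's English description precedes it below -/
import Mathlib

section
/- Let c ≥ 1 and let A₁, A₂ ∈ End(ℂᶜ). Then the pencil A₁ + λA₂ is regular (i.e., there exists (ν₁, ν₂) ∈ ℂ² with det(ν₁A₁ + ν₂A₂) ≠ 0) if and only if for every linear subspace S₀ ⊆ ℂᶜ one has dim(A₁(S₀) + A₂(S₀)) ≥ dim S₀. -/
open Matrix BigOperators

noncomputable section

/-- The space of `c × c` complex matrices, regarded as endomorphisms of `ℂ^c`. -/
abbrev Mat (c : ℕ) : Type := Matrix (Fin c) (Fin c) ℂ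

/-- `cos (π x / (c+1))` as a complex number. -/
def cmC (c : ℕ) (x : ℝ) : ℂ := Complex.ofReal (Real.cos (Real.pi * x / (c + 1)))

/-- `sin (π x / (c+1))` as a complex number. -/
def smC (c : ℕ) (x : ℝ) : ℂ := Complex.ofReal (Real.sin (Real.pi * x / (c + 1)))

/-- Condition (P1): for `n = 1`, `A₁C₁A₂ = A₂C₁A₁`; for `n > 1`,
`A₁C_q = A₂C_{q+1}` and `C_qA₁ = C_{q+1}A₂` for `q = 1, …, n-1`. -/
def CondP1 (n c : ℕ) (A1 A2 : Mat c) (C : ℕ → Mat c) : Prop :=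
  if n = 1 then A1 * C 1 * A2 = A2 * C 1 * A1
  else ∀ q : ℕ, 1 ≤ q → q ≤ n - 1 →
    A1 * C q = A2 * C (q + 1) ∧ C q * A1 = C (q + 1) * A2

/-- Condition (P2): the pencil `A₁ + λ A₂` is regular. -/
def CondP2 (c : ℕ) (A1 A2 : Mat c) : Prop :=
  ∃ ν1 ν2 : ℂ, (ν1 • A1 + ν2 • A2).det ≠ 0

/-- Condition (P3). -/
def CondP3 (n c : ℕ) (A1 A2 : Mat c) (C : ℕ → Mat c) (e : Fin c → ℂ) : Prop :=
  ∀ l1 l2 m1 m2 : ℂ, (l1, l2) ≠ (0, 0) → l1 ^ n * m1 + l2 ^ n * m2 = 0 →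
    ¬ ∃ v : Fin c → ℂ, v ≠ 0 ∧
      (C 1 * A2).mulVec v = (-m1) • v ∧
      (C n * A1).mulVec v = ((-1 : ℂ) ^ n * m2) • v ∧
      e ⬝ᵥ v = 0 ∧
      (l2 • A1 + l1 • A2).mulVec v = 0

/-- Condition (T1): `[b₁, b₂] = 0`. -/
def CondT1 (c : ℕ) (b1 b2 : Mat c) : Prop := b1 * b2 = b2 * b1

/-- Condition (T2): co-stability of the ADHM datum `(b₁, b₂, e)`. -/
def CondT2 (c : ℕ) (b1 b2 : Mat c) (e : Fin c → ℂ) : Prop :=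
  ∀ z w : ℂ, ¬ ∃ v : Fin c → ℂ, v ≠ 0 ∧
    b1.mulVec v = z • v ∧ b2.mulVec v = w • v ∧ e ⬝ᵥ v = 0

/-- `A_{1m} = c_m A₁ - s_m A₂`. -/
def Amat1 (c : ℕ) (m : ℝ) (A1 A2 : Mat c) : Mat c := cmC c m • A1 - smC c m • A2

/-- `A_{2m} = s_m A₁ + c_m A₂`. -/
def Amat2 (c : ℕ) (m : ℝ) (A1 A2 : Mat c) : Mat c := smC c m • A1 + cmC c m • A2

/-- `B_m = A_{2m}⁻¹ A_{1m}`. -/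
def Bmat (c : ℕ) (m : ℝ) (A1 A2 : Mat c) : Mat c :=
  (Amat2 c m A1 A2)⁻¹ * Amat1 c m A1 A2

/-- `E_m = (∑_{q=1}^{n} binom(n-1, q-1) c_m^{n-q} s_m^{q-1} C_q) A_{2m}`. -/
def Emat (n c : ℕ) (m : ℝ) (A1 A2 : Mat c) (C : ℕ → Mat c) : Mat c :=
  (∑ q ∈ Finset.Icc 1 n,
    (((n - 1).choose (q - 1) : ℂ) * cmC c m ^ (n - q) * smC c m ^ (q - 1)) • C q) *
    Amat2 c m A1 A2

/-- A sub-representation `(S₀, S₁)`: `A₁(S₀) ⊆ S₁`, `A₂(S₀) ⊆ S₁`,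
and `C_q(S₁) ⊆ S₀` for `q = 1, …, n`. -/
def SubRep (n c : ℕ) (A1 A2 : Mat c) (C : ℕ → Mat c)
    (S0 S1 : Submodule ℂ (Fin c → ℂ)) : Prop :=
  (∀ v ∈ S0, A1.mulVec v ∈ S1 ∧ A2.mulVec v ∈ S1) ∧
  (∀ v ∈ S1, ∀ q : ℕ, 1 ≤ q → q ≤ n → (C q).mulVec v ∈ S0)

/-- Condition (Q1): for `n = 1`, `A₁C₁A₂ = A₂C₁A₁`; for `n ≥ 2`,
`A₁C_q = A₂C_{q+1}` and `C_qA₁ + f_q∘e = C_{q+1}A₂` for `q = 1, …, n-1`. -/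
def CondQ1 (n c : ℕ) (A1 A2 : Mat c) (C : ℕ → Mat c) (e : Fin c → ℂ)
    (f : ℕ → Fin c → ℂ) : Prop :=
  if n = 1 then A1 * C 1 * A2 = A2 * C 1 * A1
  else ∀ q : ℕ, 1 ≤ q → q ≤ n - 1 →
    A1 * C q = A2 * C (q + 1) ∧ C q * A1 + vecMulVec (f q) e = C (q + 1) * A2

/-- Condition (Q2). -/
def CondQ2 (n c : ℕ) (A1 A2 : Mat c) (C : ℕ → Mat c) (e : Fin c → ℂ) : Prop :=
  ∀ S0 S1 : Submodule ℂ (Fin c → ℂ), SubRep n c A1 A2 C S0 S1 →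
    (∀ v ∈ S0, e ⬝ᵥ v = 0) →
    Module.finrank ℂ S0 ≤ Module.finrank ℂ S1 ∧
    (Module.finrank ℂ S0 = Module.finrank ℂ S1 → S0 = ⊥ ∧ S1 = ⊥)

/-- Condition (Q3) (with the framing maps `f_i`): for every sub-representation
containing all the `Im f_i`, `dim S₀ ≤ dim S₁`; for `n = 1` there are no `f`'s
and the condition applies to every sub-representation. -/
def CondQ3 (n c : ℕ) (A1 A2 : Mat c) (C : ℕ → Mat c)
    (f : ℕ → Fin c → ℂ) : Prop :=
  ∀ S0 S1 : Submodule ℂ (Fin c → ℂ), SubRep n c A1 A2 C S0 S1 →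
    (∀ i : ℕ, 1 ≤ i → i ≤ n - 1 → f i ∈ S0) →
    Module.finrank ℂ S0 ≤ Module.finrank ℂ S1

open Polynomial in
/-- A singular pencil `A + t B` over an infinite field admits a sequence of vectors, not all zero,
consisting of the coefficients of a polynomial kernel vector. -/
theorem exists_coeff_seq_of_det_pencil_eq_zero {K ι : Type*} [Field K] [Infinite K] [Fintype ι]
    [DecidableEq ι] (A B : Matrix ι ι K) (h : ∀ t : K, (A + t • B).det = 0) :
    ∃ v : ℕ → ι → K, v ≠ 0 ∧ A *ᵥ v 0 = 0 ∧ ∀ n, A *ᵥ v (n + 1) = -(B *ᵥ v n) := by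
  let M : Matrix ι ι K[X] := A.map C + (X : K[X]) • B.map C
  have hM : M.det = 0 := by
    refine Polynomial.funext fun t => ?_
    rw [← coe_evalRingHom, RingHom.map_det, map_zero, ← h t]
    congr 1
    ext i j
    simp [M, mul_comm t]
  obtain ⟨p, hp, hMp⟩ := Matrix.exists_mulVec_eq_zero_iff.mpr hM
  have hcoeff (n : ℕ) (i : ι) :
      ∑ j, ((C (A i j) + X * C (B i j)) * p j).coeff n = 0 := by
    rw [← finsetSum_coeff, ← coeff_zero n]
    exact congr_arg (coeff · n) (congr_fun hMp i)
  refine ⟨fun n j => (p j).coeff n, ?_, ?_, fun n => ?_⟩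
  · rintro h0
    refine hp (funext fun j => Polynomial.ext fun n => ?_)
    simpa using congr_fun (congr_fun h0 n) j
  · ext i
    simpa [add_mul, mul_assoc, mulVec, dotProduct] using hcoeff 0 i
  · ext i
    rw [Pi.neg_apply, eq_neg_iff_add_eq_zero]
    simpa [add_mul, mul_assoc, coeff_X_mul, Finset.sum_add_distrib, mulVec, dotProduct]
      using hcoeff (n + 1) i

/-- If `f` kills a nonzero vector of a finite-dimensional subspace, it lowers its dimension. -/
theorem Submodule.finrank_map_lt_of_apply_eq_zero {K V W : Type*} [Field K] [AddCommGroup V]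
    [Module K V] [AddCommGroup W] [Module K W] (f : V →ₗ[K] W) (S : Submodule K V)
    [FiniteDimensional K S] {x : V} (hx : x ∈ S) (hx0 : x ≠ 0) (hfx : f x = 0) :
    Module.finrank K (S.map f) < Module.finrank K S := by
  have hker : 0 < Module.finrank K (LinearMap.ker (f.domRestrict S)) := by
    refine Module.finrank_pos_iff_exists_ne_zero.mpr ⟨⟨⟨x, hx⟩, by simpa using hfx⟩, ?_⟩
    simpa [Subtype.ext_iff] using hx0
  have := (f.domRestrict S).finrank_range_add_finrank_ker
  rw [LinearMap.range_domRestrict] at this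
  omega

/-- A singular pencil has a subspace whose joint image has smaller dimension. -/
theorem exists_finrank_sup_map_lt_of_det_pencil_eq_zero {K ι : Type*} [Field K] [Infinite K]
    [Fintype ι] [DecidableEq ι] (A B : Matrix ι ι K) (h : ∀ t : K, (A + t • B).det = 0) :
    ∃ S : Submodule K (ι → K),
      Module.finrank K ↥(S.map A.mulVecLin ⊔ S.map B.mulVecLin) < Module.finrank K S := by
  classical
  obtain ⟨v, hv, hv0, hvs⟩ := exists_coeff_seq_of_det_pencil_eq_zero A B h
  have hex : ∃ n, v n ≠ 0 := Function.ne_iff.mp hv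
  obtain ⟨m, hm, hAm⟩ : ∃ m, v m ≠ 0 ∧ A *ᵥ v m = 0 := by
    refine ⟨Nat.find hex, Nat.find_spec hex, ?_⟩
    rcases hn : Nat.find hex with _ | n
    · exact hv0
    · have : v n = 0 := not_not.mp (Nat.find_min hex (by omega))
      rw [hvs, this, mulVec_zero, neg_zero]
  refine ⟨Submodule.span K (Set.range v), ?_⟩
  have hle : (Submodule.span K (Set.range v)).map B.mulVecLin ≤
      (Submodule.span K (Set.range v)).map A.mulVecLin := by
    rw [Submodule.map_span_le]
    rintro _ ⟨n, rfl⟩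
    refine ⟨-v (n + 1), neg_mem (Submodule.subset_span ⟨n + 1, rfl⟩), ?_⟩
    simp [mulVec_neg, hvs]
  rw [sup_eq_left.mpr hle]
  exact Submodule.finrank_map_lt_of_apply_eq_zero _ _ (Submodule.subset_span ⟨m, rfl⟩) hm hAm

/-- the pencil `A₁ + λ A₂` is regular iff for every subspace `S₀ ⊆ ℂ^c`
one has `dim (A₁(S₀) + A₂(S₀)) ≥ dim S₀`. -/
theorem stmt_0 (c : ℕ) (hc : 1 ≤ c) (A1 A2 : Mat c) :
    (∃ ν1 ν2 : ℂ, (ν1 • A1 + ν2 • A2).det ≠ 0) ↔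
      ∀ S0 : Submodule ℂ (Fin c → ℂ),
        Module.finrank ℂ S0 ≤
          Module.finrank ℂ ↥(S0.map A1.mulVecLin ⊔ S0.map A2.mulVecLin) := by
  constructor
  · rintro ⟨ν1, ν2, hdet⟩ S0
    have hinj : Function.Injective (ν1 • A1 + ν2 • A2).mulVecLin :=
      Matrix.mulVec_injective_of_isUnit
        ((Matrix.isUnit_iff_isUnit_det _).mpr (isUnit_iff_ne_zero.mpr hdet))
    rw [(Submodule.equivMapOfInjective _ hinj S0).finrank_eq]
    refine Submodule.finrank_mono ?_
    rintro _ ⟨x, hx, rfl⟩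
    rw [mulVecLin_apply, add_mulVec, smul_mulVec, smul_mulVec]
    exact Submodule.add_mem_sup (Submodule.smul_mem _ _ ⟨x, hx, rfl⟩)
      (Submodule.smul_mem _ _ ⟨x, hx, rfl⟩)
  · intro hS
    by_contra! hdet
    obtain ⟨S, hlt⟩ := exists_finrank_sup_map_lt_of_det_pencil_eq_zero A1 A2
      fun t => by simpa using hdet 1 t
    exact (hS S).not_gt hlt
end
end

section
/- Let n > 1, c ≥ 1, and let A₁, A₂ ∈ End(ℂᶜ) be such that the pencil A₁ + λA₂ is regular, i.e., there exists (ν₁, ν₂) ∈ ℂ² with det(ν₁A₁ + ν₂A₂) ≠ 0. Then the linear system A₁C_q = A₂C_{q+1}, q = 1, …, n−1, in the unknowns C₁, …, Cₙ ∈ End(ℂᶜ), has maximal rank (n−1)c²; equivalently, the space of solutions {(C₁, …, Cₙ) ∈ End(ℂᶜ)ⁿ : A₁C_q = A₂C_{q+1} for q = 1, …, n−1} is a linear subspace of End(ℂᶜ)ⁿ of dimension exactly c². -/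
open Matrix BigOperators

noncomputable section

section PencilRecursion

variable {K R : Type*} [Field K] [Ring R] [Algebra K R]

/-- Two elements having a linear combination equal to `1` commute. -/
theorem commute_of_smul_add_smul_eq_one {P Q : R} {a b : K} (h : a • P + b • Q = 1) :
    Commute P Q := by
  have hb : b • (P * Q) = b • (Q * P) := by
    have : P * (a • P + b • Q) = (a • P + b • Q) * P := by simp [h]
    simpa [mul_add, add_mul] using this
  by_cases b0 : b = 0
  · have ha : a • (Q * P) = a • (P * Q) := by
      have : Q * (a • P + b • Q) = (a • P + b • Q) * Q := by simp [h]
      simpa [mul_add, add_mul] using this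
    by_cases a0 : a = 0
    · have h01 : (0 : R) = 1 := by simpa [a0, b0] using h
      have := subsingleton_of_zero_eq_one h01
      exact Subsingleton.elim _ _
    · exact (smul_right_injective R a0 ha).symm
  · exact smul_right_injective R b0 hb

theorem sum_choose_smul_mul_eq_one {P Q : R} {a b : K} (h : a • P + b • Q = 1) (N : ℕ) :
    ∑ j ∈ Finset.range (N + 1), ((N.choose j : K) * a ^ j * b ^ (N - j)) • (Q ^ (N - j) * P ^ j)
      = 1 := by
  have hc := commute_of_smul_add_smul_eq_one h
  have hpow := ((hc.smul_left a).smul_right b).add_pow N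
  rw [h, one_pow] at hpow
  rw [hpow]
  refine Finset.sum_congr rfl fun j _ => ?_
  rw [smul_pow, smul_pow, ← nsmul_eq_mul', ← Nat.cast_smul_eq_nsmul K, smul_mul_smul_comm,
    smul_smul, mul_assoc, (hc.pow_pow j (N - j)).eq]

theorem pow_mul_eq_pow_mul_of_recursion {P Q : R} (hc : Commute P Q) {N : ℕ} {X : ℕ → R}
    (hX : ∀ q < N, P * X q = Q * X (q + 1)) (i d : ℕ) (hid : i + d ≤ N) :
    P ^ d * X i = Q ^ d * X (i + d) := by
  induction d with
  | zero => simp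
  | succ d ih =>
    calc P ^ (d + 1) * X i = P * (P ^ d * X i) := by rw [pow_succ', mul_assoc]
      _ = P * (Q ^ d * X (i + d)) := by rw [ih (by omega)]
      _ = Q ^ d * (P * X (i + d)) := by
        rw [← mul_assoc, (hc.pow_right d).eq, mul_assoc]
      _ = Q ^ (d + 1) * X (i + (d + 1)) := by
        rw [hX _ (by omega), ← mul_assoc, ← pow_succ, add_assoc]

theorem pow_mul_pow_mul_swap_of_recursion {P Q : R} (hc : Commute P Q) {N : ℕ} {X : ℕ → R}
    (hX : ∀ q < N, P * X q = Q * X (q + 1)) {i j : ℕ} (hi : i ≤ N) (hj : j ≤ N) :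
    Q ^ (N - i) * P ^ i * X j = Q ^ (N - j) * P ^ j * X i := by
  wlog hij : i ≤ j generalizing i j
  · exact (this hj hi (by omega)).symm
  obtain ⟨d, rfl⟩ := Nat.exists_eq_add_of_le hij
  calc Q ^ (N - i) * P ^ i * X (i + d)
      = Q ^ (N - (i + d)) * P ^ i * (Q ^ d * X (i + d)) := by
        rw [show N - i = N - (i + d) + d by omega, pow_add, mul_assoc, mul_assoc, mul_assoc,
          ← mul_assoc (Q ^ d), ← (hc.pow_pow i d).eq, mul_assoc]
    _ = Q ^ (N - (i + d)) * P ^ (i + d) * X i := by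
        rw [← pow_mul_eq_pow_mul_of_recursion hc hX i d hj, pow_add]
        simp only [mul_assoc]

/-- A solution of `P * X q = Q * X (q + 1)` is determined by a single element. -/
theorem eq_pow_mul_pow_mul_sum_of_recursion {P Q : R} {a b : K} (h : a • P + b • Q = 1)
    {N : ℕ} {X : ℕ → R} (hX : ∀ q < N, P * X q = Q * X (q + 1)) {i : ℕ} (hi : i ≤ N) :
    Q ^ (N - i) * P ^ i *
      ∑ j ∈ Finset.range (N + 1), ((N.choose j : K) * a ^ j * b ^ (N - j)) • X j = X i := by
  have hc := commute_of_smul_add_smul_eq_one h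
  conv_rhs => rw [← one_mul (X i), ← sum_choose_smul_mul_eq_one h N]
  rw [Finset.mul_sum, Finset.sum_mul]
  refine Finset.sum_congr rfl fun j hj => ?_
  rw [mul_smul_comm, smul_mul_assoc, pow_mul_pow_mul_swap_of_recursion hc hX hi
    (Finset.mem_range_succ_iff.mp hj)]

/-- The linear parametrization `Y ↦ (Q ^ (N - i) * P ^ i * Y)ᵢ`. -/
def powMulPowLinearMap (K : Type*) {R : Type*} [Field K] [Ring R] [Algebra K R] (P Q : R)
    (N : ℕ) : R →ₗ[K] (Fin (N + 1) → R) :=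
  LinearMap.pi fun i => LinearMap.mulLeft K (Q ^ (N - i) * P ^ (i : ℕ))

theorem powMulPowLinearMap_injective {P Q : R} {a b : K} (h : a • P + b • Q = 1) (N : ℕ) :
    Function.Injective (powMulPowLinearMap K P Q N) := by
  rw [← LinearMap.ker_eq_bot, LinearMap.ker_eq_bot']
  intro Y hY
  rw [← one_mul Y, ← sum_choose_smul_mul_eq_one h N, Finset.sum_mul]
  refine Finset.sum_eq_zero fun j hj => ?_
  have : Q ^ (N - j) * P ^ j * Y = 0 := congrFun hY ⟨j, Finset.mem_range.mp hj⟩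
  rw [smul_mul_assoc, this, smul_zero]

theorem mem_range_powMulPowLinearMap {P Q : R} {a b : K} (h : a • P + b • Q = 1) (N : ℕ)
    (C : Fin (N + 1) → R) :
    C ∈ LinearMap.range (powMulPowLinearMap K P Q N) ↔
      ∀ q : ℕ, ∀ hq : q + 1 < N + 1, P * C ⟨q, by omega⟩ = Q * C ⟨q + 1, hq⟩ := by
  have hc := commute_of_smul_add_smul_eq_one h
  constructor
  · rintro ⟨Y, rfl⟩ q hq
    change P * (Q ^ (N - q) * P ^ q * Y) = Q * (Q ^ (N - (q + 1)) * P ^ (q + 1) * Y)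
    rw [show N - q = N - (q + 1) + 1 by omega, pow_succ' Q, pow_succ' P]
    have hP := (hc.pow_right (N - (q + 1))).eq
    simp only [← mul_assoc]
    rw [hc.eq, mul_assoc Q P, hP, ← mul_assoc]
  · intro hC
    let X : ℕ → R := fun j => if hj : j < N + 1 then C ⟨j, hj⟩ else 0
    have hX : ∀ q < N, P * X q = Q * X (q + 1) := by
      intro q hq
      have h1 : q < N + 1 := by omega
      have h2 : q + 1 < N + 1 := by omega
      simpa only [X, dif_pos h1, dif_pos h2] using hC q h2
    refine ⟨∑ j ∈ Finset.range (N + 1), ((N.choose j : K) * a ^ j * b ^ (N - j)) • X j, ?_⟩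
    funext i
    refine (eq_pow_mul_pow_mul_sum_of_recursion h hX (Nat.lt_succ_iff.mp i.2)).trans ?_
    exact dif_pos i.2

end PencilRecursion

/-- for `n > 1` and a regular pencil `A₁ + λ A₂`, the space of solutions
`(C₁, …, Cₙ)` of the system `A₁ C_q = A₂ C_{q+1}` (`q = 1, …, n-1`) is a linear subspace
of `End(ℂ^c)ⁿ` of dimension exactly `c²` (equivalently, the system of `(n-1)c²` equations
has maximal rank).  Here `C i` stands for `C_{i+1}`. -/
theorem stmt_1 (n c : ℕ) (hn : 1 < n) (hc : 1 ≤ c) (A1 A2 : Mat c)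
    (hreg : CondP2 c A1 A2) :
    ∃ W : Submodule ℂ (Fin n → Mat c),
      (W : Set (Fin n → Mat c)) =
        {C : Fin n → Mat c | ∀ q : ℕ, ∀ h : q + 1 < n,
          A1 * C ⟨q, by omega⟩ = A2 * C ⟨q + 1, h⟩} ∧
      Module.finrank ℂ W = c ^ 2 := by
  obtain ⟨ν1, ν2, hdet⟩ := hreg
  obtain ⟨N, rfl⟩ : ∃ N, n = N + 1 := ⟨n - 1, by omega⟩
  set M : Mat c := ν1 • A1 + ν2 • A2 with hM
  have hu : IsUnit M.det := isUnit_iff_ne_zero.mpr hdet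
  have h : ν1 • (M⁻¹ * A1) + ν2 • (M⁻¹ * A2) = 1 := by
    rw [← mul_smul_comm, ← mul_smul_comm, ← mul_add, ← hM, Matrix.nonsing_inv_mul M hu]
  refine ⟨LinearMap.range (powMulPowLinearMap ℂ (M⁻¹ * A1) (M⁻¹ * A2) N), ?_, ?_⟩
  · ext C
    rw [SetLike.mem_coe, mem_range_powMulPowLinearMap h, Set.mem_ofPred_eq]
    refine forall₂_congr fun q hq => ?_
    rw [mul_assoc, mul_assoc]
    refine ⟨fun heq => ?_, fun heq => by rw [heq]⟩
    simpa only [Matrix.mul_nonsing_inv_cancel_left M _ hu] using congrArg (M * ·) heq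
  · rw [LinearMap.finrank_range_of_inj (powMulPowLinearMap_injective h N)]
    simp [Module.finrank_matrix, sq]
end
end

section
/- Let n ≥ 1, c ≥ 1, and let (A₁, A₂; C₁, …, Cₙ) with A₁, A₂, C₁, …, Cₙ ∈ End(ℂᶜ) satisfy condition (P1). Then A₁C_qA₂ = A₂C_qA₁ for every q = 1, …, n, and consequently, for every m = 0, …, c, setting c_m = cos(πm/(c+1)), s_m = sin(πm/(c+1)), A_{1m} = c_mA₁ − s_mA₂ and A_{2m} = s_mA₁ + c_mA₂, one has A_{1m}C_qA_{2m} = A_{2m}C_qA_{1m} for every q = 1, …, n. -/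
open Matrix BigOperators

noncomputable section

/-- condition (P1) implies `A₁ C_q A₂ = A₂ C_q A₁` for `q = 1, …, n`, and
consequently `A_{1m} C_q A_{2m} = A_{2m} C_q A_{1m}` for every `m = 0, …, c`. -/
theorem stmt_2 (n c : ℕ) (hn : 1 ≤ n) (hc : 1 ≤ c) (A1 A2 : Mat c)
    (C : ℕ → Mat c) (hP1 : CondP1 n c A1 A2 C) :
    (∀ q : ℕ, 1 ≤ q → q ≤ n → A1 * C q * A2 = A2 * C q * A1) ∧
    (∀ m : ℕ, m ≤ c → ∀ q : ℕ, 1 ≤ q → q ≤ n →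
      Amat1 c m A1 A2 * C q * Amat2 c m A1 A2 =
        Amat2 c m A1 A2 * C q * Amat1 c m A1 A2) := by
  have hC : ∀ q : ℕ, 1 ≤ q → q ≤ n → A1 * C q * A2 = A2 * C q * A1 := by
    intro q hq hqn
    unfold CondP1 at hP1
    split_ifs at hP1 with h
    · obtain rfl : q = 1 := by omega
      exact hP1
    · rcases hqn.lt_or_eq with hlt | rfl
      · obtain ⟨h₁, h₂⟩ := hP1 q hq (by omega)
        rw [h₁, Matrix.mul_assoc, ← h₂, ← Matrix.mul_assoc]
      · obtain ⟨k, rfl⟩ : ∃ k, q = k + 1 := ⟨q - 1, by omega⟩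
        obtain ⟨h₁, h₂⟩ := hP1 k (by omega) (by omega)
        rw [← h₁, Matrix.mul_assoc, ← h₂, ← Matrix.mul_assoc]
  refine ⟨hC, fun m _ q hq hqn => ?_⟩
  simp only [Amat1, Amat2, Matrix.sub_mul, Matrix.mul_add, Matrix.add_mul, Matrix.mul_sub,
    Matrix.smul_mul, Matrix.mul_smul, hC q hq hqn]
  module
end
end

section
/- Let n ≥ 1, c ≥ 1, m ∈ {0, …, c}, and let (A₁, A₂; C₁, …, Cₙ) with A₁, A₂, C₁, …, Cₙ ∈ End(ℂᶜ) satisfy condition (P1). Set c_m = cos(πm/(c+1)), s_m = sin(πm/(c+1)), A_{1m} = c_mA₁ − s_mA₂, A_{2m} = s_mA₁ + c_mA₂, and assume A_{2m} is invertible. Then, with B_m = A_{2m}⁻¹A_{1m}, the matrix B_m commutes with C_qA_{2m} for every q = 1, …, n; in particular, [B_m, E_m] = 0, where E_m = (Σ_{q=1}^{n} binom(n−1, q−1) c_m^{n−q} s_m^{q−1} C_q) A_{2m}. -/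
open Matrix BigOperators

noncomputable section

theorem CondP1.mul_mul_comm {n c : ℕ} {A1 A2 : Mat c} {C : ℕ → Mat c}
    (h : CondP1 n c A1 A2 C) {q : ℕ} (hq : 1 ≤ q) (hqn : q ≤ n) :
    A1 * C q * A2 = A2 * C q * A1 := by
  unfold CondP1 at h
  split_ifs at h with hn
  · obtain rfl : q = 1 := by omega
    exact h
  · rcases hqn.lt_or_eq with hlt | rfl
    · obtain ⟨h1, h2⟩ := h q hq (by omega)
      rw [h1, mul_assoc, mul_assoc, h2]
    · obtain ⟨p, rfl⟩ : ∃ p, q = p + 1 := ⟨q - 1, by omega⟩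
      obtain ⟨h1, h2⟩ := h p (by omega) (by omega)
      rw [← h1, mul_assoc, mul_assoc, h2]

theorem Amat1_mul_mul_Amat2_comm {c : ℕ} (m : ℝ) {A1 A2 X : Mat c}
    (h : A1 * X * A2 = A2 * X * A1) :
    Amat1 c m A1 A2 * X * Amat2 c m A1 A2 = Amat2 c m A1 A2 * X * Amat1 c m A1 A2 := by
  simp only [Amat1, Amat2, add_mul, sub_mul, mul_add, mul_sub, smul_mul_assoc,
    mul_smul_comm, h]
  module

theorem commute_Bmat_mul_Amat2 {c : ℕ} (m : ℝ) {A1 A2 X : Mat c}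
    (hinv : IsUnit (Amat2 c m A1 A2)) (h : A1 * X * A2 = A2 * X * A1) :
    Commute (Bmat c m A1 A2) (X * Amat2 c m A1 A2) := by
  have hdet := (Matrix.isUnit_iff_isUnit_det _).mp hinv
  have hcomm := Amat1_mul_mul_Amat2_comm m h
  simp only [mul_assoc] at hcomm
  rw [Commute, SemiconjBy, Bmat, mul_assoc, mul_assoc, hcomm,
    Matrix.nonsing_inv_mul_cancel_left _ _ hdet, Matrix.mul_nonsing_inv_cancel_left _ _ hdet]

/-- under (P1) and invertibility of `A_{2m}`, the matrix `B_m = A_{2m}⁻¹ A_{1m}`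
commutes with `C_q A_{2m}` for every `q = 1, …, n`; in particular `[B_m, E_m] = 0`. -/
theorem stmt_3 (n c m : ℕ) (hn : 1 ≤ n) (hc : 1 ≤ c) (hm : m ≤ c)
    (A1 A2 : Mat c) (C : ℕ → Mat c) (hP1 : CondP1 n c A1 A2 C)
    (hinv : IsUnit (Amat2 c m A1 A2)) :
    (∀ q : ℕ, 1 ≤ q → q ≤ n →
      Bmat c m A1 A2 * (C q * Amat2 c m A1 A2) =
        (C q * Amat2 c m A1 A2) * Bmat c m A1 A2) ∧
    Bmat c m A1 A2 * Emat n c m A1 A2 C =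
      Emat n c m A1 A2 C * Bmat c m A1 A2 := by
  have hcomm : ∀ q : ℕ, 1 ≤ q → q ≤ n →
      Commute (Bmat c m A1 A2) (C q * Amat2 c m A1 A2) := fun q hq hqn =>
    commute_Bmat_mul_Amat2 m hinv (hP1.mul_mul_comm hq hqn)
  refine ⟨fun q hq hqn => (hcomm q hq hqn).eq, ?_⟩
  rw [Emat, Finset.sum_mul]
  refine (Commute.sum_right _ _ _ fun q hq => ?_).eq
  rw [Finset.mem_Icc] at hq
  rw [smul_mul_assoc]
  exact (hcomm q hq.1 hq.2).smul_right _
end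
end

section
/- Let n ≥ 1, c ≥ 1, m ∈ {0, …, c}, and let (A₁, A₂; C₁, …, Cₙ; e), with A₁, A₂, C₁, …, Cₙ ∈ End(ℂᶜ) and e ∈ Hom(ℂᶜ, ℂ), satisfy condition (P1); set c_m = cos(πm/(c+1)), s_m = sin(πm/(c+1)), A_{1m} = c_mA₁ − s_mA₂, A_{2m} = s_mA₁ + c_mA₂, and assume A_{2m} is invertible. Set B_m = A_{2m}⁻¹A_{1m} and E_m = (Σ_{q=1}^{n} binom(n−1, q−1) c_m^{n−q} s_m^{q−1} C_q) A_{2m}. Then (A₁, A₂; C₁, …, Cₙ; e) satisfies condition (P3) if and only if the triple (B_m, E_m, e) satisfies condition (T2). -/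
open Matrix BigOperators

noncomputable section

section GeometricRelation

variable {K V : Type*} [Field K] [AddCommGroup V] [Module K V]

/-- A finite sequence with constant projective ratio `[b : a]` is, up to a common vector, the
sequence of monomials of fixed degree in `a` and `b`. -/
theorem exists_eq_pow_smul_of_smul_eq_smul_succ (a b : K) (hab : a ≠ 0 ∨ b ≠ 0) (N : ℕ)
    (y : ℕ → V) (hy : ∀ k < N, a • y k = b • y (k + 1)) :
    ∃ x : V, ∀ k ≤ N, y k = (a ^ k * b ^ (N - k)) • x := by
  by_cases hb : b = 0
  · subst hb
    have ha : a ≠ 0 := by simpa using hab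
    refine ⟨(a ^ N)⁻¹ • y N, fun k hk => ?_⟩
    rcases hk.lt_or_eq with h | rfl
    · have h0 : y k = 0 := by simpa [ha] using hy k h
      rw [h0, zero_pow (by omega), mul_zero, zero_smul]
    · rw [smul_smul, Nat.sub_self, pow_zero, mul_one, mul_inv_cancel₀ (pow_ne_zero _ ha), one_smul]
  · refine ⟨(b ^ N)⁻¹ • y 0, fun k => ?_⟩
    induction k with
    | zero =>
      intro _
      rw [smul_smul, pow_zero, one_mul, Nat.sub_zero, mul_inv_cancel₀ (pow_ne_zero _ hb), one_smul]
    | succ k ih =>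
      intro hk
      have h := hy k hk
      rw [ih (by omega), smul_smul] at h
      have h' := congrArg (fun x => b⁻¹ • x) h
      simp only [smul_smul, inv_mul_cancel₀ hb, one_smul] at h'
      rw [← h', smul_smul]
      congr 1
      rw [show N - k = (N - (k + 1)) + 1 by omega]
      field_simp
      ring

/-- Under the normalization `s * a + t * b = 1`, the common vector of such a sequence is its
binomial average. -/
theorem eq_pow_smul_sum_of_smul_eq_smul_succ (a b s t : K) (h1 : s * a + t * b = 1) (n : ℕ)
    (hn : 1 ≤ n) (y : ℕ → V) (hy : ∀ q, 1 ≤ q → q ≤ n - 1 → a • y q = b • y (q + 1))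
    (q : ℕ) (hq : 1 ≤ q) (hqn : q ≤ n) :
    y q = (a ^ (q - 1) * b ^ (n - q)) • ∑ j ∈ Finset.Icc 1 n,
      (((n - 1).choose (j - 1) : K) * t ^ (n - j) * s ^ (j - 1)) • y j := by
  obtain ⟨N, rfl⟩ : ∃ N, n = N + 1 := ⟨n - 1, by omega⟩
  have hab : a ≠ 0 ∨ b ≠ 0 := by
    by_contra! h
    simp [h.1, h.2] at h1
  obtain ⟨x, hx⟩ := exists_eq_pow_smul_of_smul_eq_smul_succ a b hab N (fun k => y (k + 1))
    (fun k hk => hy (k + 1) (by omega) (by omega))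
  have hsum : ∑ j ∈ Finset.Icc 1 (N + 1),
      (((N + 1 - 1).choose (j - 1) : K) * t ^ (N + 1 - j) * s ^ (j - 1)) • y j = x := by
    rw [← Finset.Ico_add_one_right_eq_Icc, Finset.sum_Ico_eq_sum_range]
    have hbin := add_pow (s * a) (t * b) N
    rw [h1, one_pow] at hbin
    conv_rhs => rw [← one_smul K x, hbin, Finset.sum_smul]
    refine Finset.sum_congr rfl fun k hk => ?_
    have hk' : k ≤ N := by
      have := Finset.mem_range.mp hk
      omega
    rw [add_comm 1 k, hx k hk', smul_smul, Nat.add_sub_cancel, Nat.add_sub_cancel,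
      Nat.add_sub_add_right]
    congr 1
    ring
  rw [hsum]
  obtain ⟨k, rfl⟩ : ∃ k, q = k + 1 := ⟨q - 1, by omega⟩
  rw [hx k (by omega), Nat.add_sub_cancel, Nat.add_sub_add_right]

end GeometricRelation

theorem smC_mul_self_add_cmC_mul_self (c : ℕ) (x : ℝ) :
    smC c x * smC c x + cmC c x * cmC c x = 1 := by
  unfold smC cmC
  exact_mod_cast (by
    rw [← sq, ← sq, Real.sin_sq_add_cos_sq] :
      Real.sin (Real.pi * x / (c + 1)) * Real.sin (Real.pi * x / (c + 1)) +
      Real.cos (Real.pi * x / (c + 1)) * Real.cos (Real.pi * x / (c + 1)) = 1)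

/-- `B_m v = z v` says that `A_{1m} v = z A_{2m} v`. -/
theorem Bmat_mulVec_eq_smul_iff (c : ℕ) (x : ℝ) (A1 A2 : Mat c) (hinv : IsUnit (Amat2 c x A1 A2))
    (v : Fin c → ℂ) (z : ℂ) :
    Bmat c x A1 A2 *ᵥ v = z • v ↔ Amat1 c x A1 A2 *ᵥ v = z • (Amat2 c x A1 A2 *ᵥ v) := by
  have hdet := (Matrix.isUnit_iff_isUnit_det _).mp hinv
  unfold Bmat
  constructor <;> intro h
  · rw [← mulVec_smul, ← h, mulVec_mulVec, Matrix.mul_nonsing_inv_cancel_left _ _ hdet]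
  · rw [← mulVec_mulVec, h, mulVec_smul, mulVec_mulVec, Matrix.nonsing_inv_mul _ hdet, one_mulVec]

/-- On an eigenvector of `B_m` with eigenvalue `z`, the matrices `A₁` and `A₂` are multiples of
`A_{2m}`. -/
theorem mulVec_eq_smul_Amat2_mulVec (c : ℕ) (x : ℝ) (A1 A2 : Mat c) (v : Fin c → ℂ) (z : ℂ)
    (h : Amat1 c x A1 A2 *ᵥ v = z • (Amat2 c x A1 A2 *ᵥ v)) :
    A1 *ᵥ v = (cmC c x * z + smC c x) • (Amat2 c x A1 A2 *ᵥ v) ∧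
      A2 *ᵥ v = (cmC c x - smC c x * z) • (Amat2 c x A1 A2 *ᵥ v) := by
  have h1 := smC_mul_self_add_cmC_mul_self c x
  constructor
  · rw [add_smul, mul_smul, ← h]
    simp only [Amat1, Amat2, add_mulVec, sub_mulVec, smul_mulVec]
    linear_combination (norm := module) (-h1) • (A1 *ᵥ v)
  · rw [sub_smul, mul_smul, ← h]
    simp only [Amat1, Amat2, add_mulVec, sub_mulVec, smul_mulVec]
    linear_combination (norm := module) (-h1) • (A2 *ᵥ v)

/-- On an eigenvector of `B_m`, the matrices `C₁A₂` and `CₙA₁` are multiples of `E_m`. -/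
theorem mulVec_eq_pow_smul_Emat_mulVec (n c : ℕ) (x : ℝ) (hn : 1 ≤ n) (A1 A2 : Mat c)
    (C : ℕ → Mat c) (hP1 : CondP1 n c A1 A2 C) (v : Fin c → ℂ) (z : ℂ)
    (h : Amat1 c x A1 A2 *ᵥ v = z • (Amat2 c x A1 A2 *ᵥ v)) :
    (C 1 * A2) *ᵥ v = (cmC c x - smC c x * z) ^ n • (Emat n c x A1 A2 C *ᵥ v) ∧
      (C n * A1) *ᵥ v = (cmC c x * z + smC c x) ^ n • (Emat n c x A1 A2 C *ᵥ v) := by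
  obtain ⟨hA1, hA2⟩ := mulVec_eq_smul_Amat2_mulVec c x A1 A2 v z h
  have h1 := smC_mul_self_add_cmC_mul_self c x
  have key := eq_pow_smul_sum_of_smul_eq_smul_succ (cmC c x * z + smC c x) (cmC c x - smC c x * z)
    (smC c x) (cmC c x) (by linear_combination h1) n hn
    (fun q => C q *ᵥ (Amat2 c x A1 A2 *ᵥ v)) (fun q hq hqn => by
      have hne : n ≠ 1 := by omega
      rw [CondP1, if_neg hne] at hP1
      have hC := congrArg (fun M => M *ᵥ v) (hP1 q hq hqn).2
      simpa only [← mulVec_mulVec, hA1, hA2, mulVec_smul] using hC)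
  have hE : ∑ j ∈ Finset.Icc 1 n,
      (((n - 1).choose (j - 1) : ℂ) * cmC c x ^ (n - j) * smC c x ^ (j - 1)) •
        (C j *ᵥ (Amat2 c x A1 A2 *ᵥ v)) = Emat n c x A1 A2 C *ᵥ v := by
    simp only [Emat, ← mulVec_mulVec, sum_mulVec, smul_mulVec]
  simp only [hE] at key
  obtain ⟨N, rfl⟩ : ∃ N, n = N + 1 := ⟨n - 1, by omega⟩
  constructor
  · rw [← mulVec_mulVec, hA2, mulVec_smul, key 1 le_rfl hn, smul_smul]
    simp [pow_succ']
  · rw [← mulVec_mulVec, hA1, mulVec_smul, key (N + 1) hn le_rfl, smul_smul]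
    simp [pow_succ']

/-- A nonzero vector in the kernel of a member of the pencil is an eigenvector of `B_m`. -/
theorem exists_Amat1_mulVec_eq_smul (c : ℕ) (x : ℝ) (A1 A2 : Mat c)
    (hinv : IsUnit (Amat2 c x A1 A2)) (l1 l2 : ℂ) (hl : (l1, l2) ≠ (0, 0)) (v : Fin c → ℂ)
    (hv : v ≠ 0) (h : (l2 • A1 + l1 • A2) *ᵥ v = 0) :
    ∃ z : ℂ, Amat1 c x A1 A2 *ᵥ v = z • (Amat2 c x A1 A2 *ᵥ v) := by
  have h1 := smC_mul_self_add_cmC_mul_self c x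
  have hrot : (l2 * cmC c x - l1 * smC c x) • (Amat1 c x A1 A2 *ᵥ v) +
      (l2 * smC c x + l1 * cmC c x) • (Amat2 c x A1 A2 *ᵥ v) = 0 := by
    rw [← h]
    simp only [Amat1, Amat2, add_mulVec, sub_mulVec, smul_mulVec]
    linear_combination (norm := module) (l2 * h1) • (A1 *ᵥ v) + (l1 * h1) • (A2 *ᵥ v)
  have hu : Amat2 c x A1 A2 *ᵥ v ≠ 0 := fun h0 =>
    hv (Matrix.mulVec_injective_of_isUnit hinv (by rw [h0, mulVec_zero]))
  have hne : l2 * cmC c x - l1 * smC c x ≠ 0 := by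
    intro h0
    rw [h0, zero_smul, zero_add] at hrot
    have h0' := (smul_eq_zero.mp hrot).resolve_right hu
    apply hl
    rw [Prod.mk.injEq]
    constructor
    · linear_combination (-l1) * h1 - smC c x * h0 + cmC c x * h0'
    · linear_combination (-l2) * h1 + cmC c x * h0 + smC c x * h0'
  refine ⟨-(l2 * smC c x + l1 * cmC c x) / (l2 * cmC c x - l1 * smC c x), ?_⟩
  rw [div_eq_inv_mul, mul_smul, neg_smul, ← eq_neg_of_add_eq_zero_left hrot, smul_smul,
    inv_mul_cancel₀ hne, one_smul]

/-- under (P1) and invertibility of `A_{2m}`, condition (P3) holds for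
`(A₁, A₂; C₁, …, Cₙ; e)` iff condition (T2) holds for the triple `(B_m, E_m, e)`. -/
theorem stmt_4 (n c m : ℕ) (hn : 1 ≤ n) (hc : 1 ≤ c) (hm : m ≤ c)
    (A1 A2 : Mat c) (C : ℕ → Mat c) (e : Fin c → ℂ)
    (hP1 : CondP1 n c A1 A2 C) (hinv : IsUnit (Amat2 c m A1 A2)) :
    CondP3 n c A1 A2 C e ↔
      CondT2 c (Bmat c m A1 A2) (Emat n c m A1 A2 C) e := by
  have h1 := smC_mul_self_add_cmC_mul_self c m
  constructor
  · rintro hP3 z w ⟨v, hv, hB, hE, he⟩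
    have hz := (Bmat_mulVec_eq_smul_iff c m A1 A2 hinv v z).mp hB
    obtain ⟨hA1, hA2⟩ := mulVec_eq_smul_Amat2_mulVec c m A1 A2 v z hz
    obtain ⟨hC1, hCn⟩ := mulVec_eq_pow_smul_Emat_mulVec n c m hn A1 A2 C hP1 v z hz
    set a := cmC c m * z + smC c m with ha
    set b := cmC c m - smC c m * z with hb
    have hsq : ((-1 : ℂ) ^ n) * (-1) ^ n = 1 := by rw [← mul_pow]; simp
    refine hP3 (-a) b (-(b ^ n * w)) ((-1) ^ n * (a ^ n * w)) ?_ ?_ ⟨v, hv, ?_, ?_, he, ?_⟩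
    · intro h
      rw [Prod.mk.injEq] at h
      have : (1 : ℂ) = 0 := by
        linear_combination (-h1) - smC c m * h.1 + cmC c m * h.2 + smC c m * ha + cmC c m * hb
      exact one_ne_zero this
    · rw [neg_pow]
      ring
    · rw [hC1, hE, smul_smul, neg_neg]
    · rw [hCn, hE, smul_smul, ← mul_assoc, hsq, one_mul]
    · rw [add_mulVec, smul_mulVec, smul_mulVec, hA1, hA2, smul_smul, smul_smul, ← add_smul]
      rw [show b * a + -a * b = 0 by ring, zero_smul]
  · rintro hT2 l1 l2 m1 m2 hl - ⟨v, hv, h1v, hnv, he, hker⟩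
    obtain ⟨z, hz⟩ := exists_Amat1_mulVec_eq_smul c m A1 A2 hinv l1 l2 hl v hv hker
    obtain ⟨hC1, hCn⟩ := mulVec_eq_pow_smul_Emat_mulVec n c m hn A1 A2 C hP1 v z hz
    have hB := (Bmat_mulVec_eq_smul_iff c m A1 A2 hinv v z).mpr hz
    rw [h1v] at hC1
    rw [hnv] at hCn
    by_cases hb : cmC c m - smC c m * z = 0
    · have ha : cmC c m * z + smC c m ≠ 0 := by
        intro ha
        have : (1 : ℂ) = 0 := by linear_combination (-h1) + smC c m * ha + cmC c m * hb
        exact one_ne_zero this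
      rw [← inv_smul_eq_iff₀ (pow_ne_zero n ha), smul_smul] at hCn
      exact hT2 z _ ⟨v, hv, hB, hCn.symm, he⟩
    · rw [← inv_smul_eq_iff₀ (pow_ne_zero n hb), smul_smul] at hC1
      exact hT2 z _ ⟨v, hv, hB, hC1.symm, he⟩
end
end

section
/- Let n ≥ 1, c ≥ 1, and let (A₁, A₂; C₁, …, Cₙ) with A₁, A₂, C₁, …, Cₙ ∈ End(ℂᶜ) satisfy conditions (P1) and (P2). Then there exist a nonzero vector v ∈ ℂᶜ and parameters ([λ₁, λ₂], (μ₁, μ₂)) ∈ ℙ¹ × ℂ² such that λ₁ⁿμ₁ + λ₂ⁿμ₂ = 0, (λ₂A₁ + λ₁A₂)v = 0, C₁A₂v = −μ₁v, and CₙA₁v = (−1)ⁿμ₂v. -/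
open Matrix BigOperators

noncomputable section

/-- If `ker P` is nonzero and `M`-invariant, it contains an eigenvector of `M`. -/
theorem exists_eigenvector_mem_ker {c : ℕ} (P M : Mat c) (hP : P.det = 0)
    (hM : ∀ v, P *ᵥ v = 0 → P *ᵥ (M *ᵥ v) = 0) :
    ∃ (v : Fin c → ℂ) (m : ℂ), v ≠ 0 ∧ P *ᵥ v = 0 ∧ M *ᵥ v = m • v := by
  obtain ⟨w, hw0, hw⟩ := Matrix.exists_mulVec_eq_zero_iff.mpr hP
  let K : Submodule ℂ (Fin c → ℂ) := LinearMap.ker P.mulVecLin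
  have hK : ∀ v ∈ K, M.mulVecLin v ∈ K := fun v hv => hM v hv
  have : Nontrivial K := ⟨⟨⟨w, hw⟩, 0, fun h => hw0 (congrArg Subtype.val h)⟩⟩
  obtain ⟨m, hm⟩ := Module.End.exists_eigenvalue (M.mulVecLin.restrict hK)
  obtain ⟨v, hv⟩ := hm.exists_hasEigenvector
  exact ⟨v, m, fun h => hv.2 (Subtype.ext h), v.2, congrArg Subtype.val hv.apply_eq_smul⟩

/-- A pencil `A1 - t A2` with `A2` invertible is singular for some `t`. -/
theorem exists_det_sub_smul_eq_zero {c : ℕ} (hc : 1 ≤ c) (A1 A2 : Mat c) (h : A2.det ≠ 0) :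
    ∃ t : ℂ, (A1 - t • A2).det = 0 := by
  have : Nonempty (Fin c) := ⟨⟨0, hc⟩⟩
  obtain ⟨t, ht⟩ := Module.End.exists_eigenvalue (A2⁻¹ * A1).mulVecLin
  obtain ⟨v, hv⟩ := ht.exists_hasEigenvector
  refine ⟨t, Matrix.exists_mulVec_eq_zero_iff.mp ⟨v, hv.2, ?_⟩⟩
  have e : (A2⁻¹ * A1) *ᵥ v = t • v := hv.apply_eq_smul
  have e' := congrArg (A2 *ᵥ ·) e
  simp only [mulVec_mulVec, mulVec_smul, ← mul_assoc,
    Matrix.mul_nonsing_inv A2 (isUnit_iff_ne_zero.mpr h), one_mul] at e'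
  rw [sub_mulVec, smul_mulVec, e', sub_self]

/-- Under (P1), `C q A1` acts on `ker (A1 - t A2)` as `t ^ q • C 1 A2`. -/
theorem CondP1.mulVec_eq_pow_smul {n c : ℕ} {A1 A2 : Mat c} {C : ℕ → Mat c}
    (h : CondP1 n c A1 A2 C) {t : ℂ} {v : Fin c → ℂ} (hv : A1 *ᵥ v = t • A2 *ᵥ v)
    {q : ℕ} (hq : 1 ≤ q) (hqn : q ≤ n) :
    (C q * A1) *ᵥ v = t ^ q • (C 1 * A2) *ᵥ v := by
  induction q, hq using Nat.le_induction with
  | base => rw [← mulVec_mulVec, hv, mulVec_smul, mulVec_mulVec, pow_one]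
  | succ q hq ih =>
    rw [CondP1, if_neg (by omega)] at h
    rw [← mulVec_mulVec, hv, mulVec_smul, mulVec_mulVec, ← (h q hq (by omega)).2,
      ih (by omega), smul_smul, pow_succ']

/-- under (P1) and (P2) there exist a nonzero `v` and parameters
`([λ₁, λ₂], (μ₁, μ₂)) ∈ ℙ¹ × ℂ²` with `λ₁ⁿμ₁ + λ₂ⁿμ₂ = 0`, `(λ₂A₁ + λ₁A₂)v = 0`,
`C₁A₂v = -μ₁ v` and `CₙA₁v = (-1)ⁿ μ₂ v`. -/
theorem stmt_5 (n c : ℕ) (hn : 1 ≤ n) (hc : 1 ≤ c) (A1 A2 : Mat c)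
    (C : ℕ → Mat c) (hP1 : CondP1 n c A1 A2 C) (hP2 : CondP2 c A1 A2) :
    ∃ (v : Fin c → ℂ) (l1 l2 m1 m2 : ℂ), v ≠ 0 ∧ (l1, l2) ≠ (0, 0) ∧
      l1 ^ n * m1 + l2 ^ n * m2 = 0 ∧
      (l2 • A1 + l1 • A2).mulVec v = 0 ∧
      (C 1 * A2).mulVec v = (-m1) • v ∧
      (C n * A1).mulVec v = ((-1 : ℂ) ^ n * m2) • v := by
  by_cases hA : A2.det = 0
  · obtain ⟨v, m, hv0, hv, hm⟩ := exists_eigenvector_mem_ker A2 (C n * A1) hA fun v hv => by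
      rw [mulVec_mulVec, ← mul_assoc, ← hP1.mul_mul_comm hn le_rfl, ← mulVec_mulVec, hv,
        mulVec_zero]
    refine ⟨v, 1, 0, 0, (-1) ^ n * m, hv0, by simp, ?_, by simpa using hv, ?_, ?_⟩
    · simp [show n ≠ 0 by omega]
    · rw [← mulVec_mulVec, hv]
      simp
    · rw [hm, ← mul_assoc, ← mul_pow]
      simp
  · obtain ⟨t, ht⟩ := exists_det_sub_smul_eq_zero hc A1 A2 hA
    have ker_iff : ∀ v, (A1 - t • A2) *ᵥ v = 0 ↔ A1 *ᵥ v = t • A2 *ᵥ v := fun v => by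
      rw [sub_mulVec, smul_mulVec, sub_eq_zero]
    obtain ⟨v, m, hv0, hv, hm⟩ := exists_eigenvector_mem_ker (A1 - t • A2) (C 1 * A2) ht
      fun v hv => by
        rw [ker_iff] at hv ⊢
        rw [mulVec_mulVec, ← mul_assoc, hP1.mul_mul_comm le_rfl hn, ← mulVec_mulVec, hv,
          mulVec_smul, mulVec_mulVec, mulVec_mulVec, mul_assoc]
    rw [ker_iff] at hv
    refine ⟨v, -t, 1, -m, (-t) ^ n * m, hv0, by simp, by ring, ?_, by simpa using hm, ?_⟩
    · simp [add_mulVec, neg_mulVec, smul_mulVec, hv]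
    · rw [hP1.mulVec_eq_pow_smul hv hn le_rfl, hm, smul_smul, ← mul_assoc, ← mul_pow]
      simp
end
end

section
/- Let n ≥ 1, c ≥ 1, m ∈ {0, …, c}, and set c_m = cos(πm/(c+1)), s_m = sin(πm/(c+1)). Let Pⁿ(c)_m denote the set of tuples (A₁, A₂; C₁, …, Cₙ; e), with A₁, A₂, C₁, …, Cₙ ∈ End(ℂᶜ) and e ∈ Hom(ℂᶜ, ℂ), satisfying conditions (P1), (P2), (P3) and such that A_{2m} := s_mA₁ + c_mA₂ is invertible. Then the map ζ_m sending (A₁, A₂; C₁, …, Cₙ; e) to (B_m, E_m, e; A_{2m}), where B_m = A_{2m}⁻¹A_{1m} with A_{1m} = c_mA₁ − s_mA₂, and E_m = (Σ_{q=1}^{n} binom(n−1, q−1) c_m^{n−q} s_m^{q−1} C_q) A_{2m}, is a bijection from Pⁿ(c)_m onto T(c) × GL(c, ℂ). -/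
open Matrix BigOperators

noncomputable section

/-- Extension of a `Fin n`-indexed family `C₁, …, Cₙ` (stored as `C 0, …, C (n-1)`)
to a `ℕ`-indexed family, with `C_q` at index `q` for `1 ≤ q ≤ n` and `0` elsewhere. -/
def extC (n c : ℕ) (C : Fin n → Mat c) : ℕ → Mat c :=
  fun q => if h : 1 ≤ q ∧ q ≤ n then C ⟨q - 1, by omega⟩ else 0

theorem Commute.pow_mul_of_pencil {R : Type*} [Ring R] {N : ℕ} {P Q : R} (hPQ : Commute P Q)
    {D : ℕ → R} (hD : ∀ k < N, P * D k = Q * D (k + 1)) (i d : ℕ) (h : i + d ≤ N) :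
    P ^ d * D i = Q ^ d * D (i + d) := by
  induction d with
  | zero => simp
  | succ d ih =>
    have hc : Commute P (Q ^ d) := hPQ.pow_right d
    rw [pow_succ', mul_assoc, ih (by omega), ← mul_assoc, hc.eq, mul_assoc, hD _ (by omega),
      pow_succ, mul_assoc, add_assoc]

theorem Commute.pencil_exchange {R : Type*} [Ring R] {N : ℕ} {P Q : R} (hPQ : Commute P Q)
    {D : ℕ → R} (hD : ∀ k < N, P * D k = Q * D (k + 1)) {i j : ℕ} (hi : i ≤ N) (hj : j ≤ N) :
    Q ^ (N - i) * P ^ i * D j = Q ^ (N - j) * P ^ j * D i := by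
  wlog hij : i ≤ j generalizing i j
  · exact (this hj hi (by omega)).symm
  obtain ⟨d, rfl⟩ := Nat.exists_eq_add_of_le hij
  have hc : Commute (Q ^ d) (P ^ i) := (hPQ.symm.pow_pow d i)
  rw [show N - i = (N - (i + d)) + d by omega, pow_add, mul_assoc (Q ^ (N - (i + d))), hc.eq,
    pow_add P, mul_assoc, mul_assoc, mul_assoc, mul_assoc, hPQ.pow_mul_of_pencil hD i d hj]

/-- The binomial expansion of `(x Q + y P) ^ N` when `x Q + y P = 1`. -/
theorem Commute.sum_pencil_eq_one {R : Type*} [Ring R] [Algebra ℂ R] (N : ℕ) {P Q : R}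
    (hPQ : Commute P Q) {x y : ℂ} (h1 : y • P + x • Q = 1) :
    ∑ j ∈ Finset.range (N + 1), ((N.choose j : ℂ) * x ^ (N - j) * y ^ j) •
      (Q ^ (N - j) * P ^ j) = 1 := by
  have h := ((hPQ.smul_left y).smul_right x).add_pow N
  rw [h1, one_pow] at h
  rw [h]
  refine Finset.sum_congr rfl fun j _ => ?_
  rw [smul_pow, smul_pow, smul_mul_smul_comm, (hPQ.pow_pow j (N - j)).eq, ← Nat.cast_comm,
    ← nsmul_eq_mul (α := R), ← Nat.cast_smul_eq_nsmul ℂ, smul_smul, mul_assoc,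
    mul_comm (y ^ j)]

theorem Commute.pencil_solution {R : Type*} [Ring R] [Algebra ℂ R] {N : ℕ} {P Q : R}
    (hPQ : Commute P Q) {x y : ℂ} (h1 : y • P + x • Q = 1) {D : ℕ → R}
    (hD : ∀ k < N, P * D k = Q * D (k + 1)) {k : ℕ} (hk : k ≤ N) :
    D k = Q ^ (N - k) * P ^ k * ∑ j ∈ Finset.range (N + 1),
      ((N.choose j : ℂ) * x ^ (N - j) * y ^ j) • D j := by
  rw [Finset.mul_sum]
  conv_lhs => rw [← one_mul (D k), ← hPQ.sum_pencil_eq_one N h1, Finset.sum_mul]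
  refine Finset.sum_congr rfl fun j hj => ?_
  have hj : j ≤ N := by simpa [Nat.lt_succ_iff] using hj
  rw [mul_smul_comm, hPQ.pencil_exchange hD hk hj, smul_mul_assoc]

theorem Commute.pencil_solution_right {R : Type*} [Ring R] [Algebra ℂ R] {N : ℕ} {P Q : R}
    (hPQ : Commute P Q) {x y : ℂ} (h1 : y • P + x • Q = 1) {D : ℕ → R}
    (hD : ∀ k < N, D k * P = D (k + 1) * Q) {k : ℕ} (hk : k ≤ N) :
    D k = (∑ j ∈ Finset.range (N + 1),
      ((N.choose j : ℂ) * x ^ (N - j) * y ^ j) • D j) * (Q ^ (N - k) * P ^ k) := by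
  have h := Commute.pencil_solution (R := Rᵐᵒᵖ) (N := N) (P := MulOpposite.op P)
    (Q := MulOpposite.op Q) (x := x) (y := y) (D := fun j => MulOpposite.op (D j))
    hPQ.op (by rw [← MulOpposite.op_smul, ← MulOpposite.op_smul, ← MulOpposite.op_add, h1,
      MulOpposite.op_one]) (fun k hk => by
        rw [← MulOpposite.op_mul, ← MulOpposite.op_mul, hD k hk]) hk
  have h' := congrArg MulOpposite.unop h
  simp only [MulOpposite.unop_op, MulOpposite.unop_mul, MulOpposite.unop_pow,
    Finset.unop_sum, MulOpposite.unop_smul] at h'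
  rw [(hPQ.symm.pow_pow (N - k) k).eq]
  exact h'

theorem commute_of_commute_pencil {R : Type*} [Ring R] [Algebra ℂ R] {P Q E : R} {x y : ℂ}
    (hPQ : Commute P Q) (h1 : y • P + x • Q = 1) (N : ℕ)
    (h : ∀ a b, a + b = N + 1 → Commute (Q ^ a * P ^ b) E) : Commute P E ∧ Commute Q E := by
  induction N with
  | zero => exact ⟨by simpa using h 0 1 rfl, by simpa using h 1 0 rfl⟩
  | succ N ih =>
    refine ih fun a b hab => ?_
    have key : Q ^ a * P ^ b = y • (Q ^ a * P ^ (b + 1)) + x • (Q ^ (a + 1) * P ^ b) := by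
      conv_lhs => rw [← mul_one (P ^ b), ← h1]
      rw [mul_add, mul_add, mul_smul_comm, mul_smul_comm, mul_smul_comm, mul_smul_comm,
        ← pow_succ, (hPQ.pow_left b).eq, ← mul_assoc, ← pow_succ]
    rw [key]
    exact ((h _ _ (by omega)).smul_left y).add_left ((h _ _ (by omega)).smul_left x)

theorem commute_of_mul_mul_eq {R : Type*} [Ring R] [Algebra ℂ R] {P Q E : R} {x y : ℂ}
    (h1 : y • P + x • Q = 1) (h : P * E * Q = Q * E * P) : Commute P E ∧ Commute Q E := by
  constructor
  · have e1 : P * E = P * E * (y • P + x • Q) := by rw [h1, mul_one]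
    have e2 : E * P = (y • P + x • Q) * (E * P) := by rw [h1, one_mul]
    rw [Commute, SemiconjBy, e1, e2]
    simp only [mul_add, add_mul, mul_smul_comm, smul_mul_assoc, ← mul_assoc, h]
  · have e1 : Q * E = Q * E * (y • P + x • Q) := by rw [h1, mul_one]
    have e2 : E * Q = (y • P + x • Q) * (E * Q) := by rw [h1, one_mul]
    rw [Commute, SemiconjBy, e1, e2]
    simp only [mul_add, add_mul, mul_smul_comm, smul_mul_assoc, ← mul_assoc, h]

theorem Matrix.pow_mulVec_of_eigen {c : ℕ} {M : Mat c} {v : Fin c → ℂ} {z : ℂ}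
    (h : M *ᵥ v = z • v) (k : ℕ) : (M ^ k) *ᵥ v = z ^ k • v := by
  induction k with
  | zero => simp
  | succ k ih => rw [pow_succ, ← mulVec_mulVec, h, mulVec_smul, ih, smul_smul, pow_succ']

theorem cmC_sq_add_smC_sq (c : ℕ) (t : ℝ) : cmC c t * cmC c t + smC c t * smC c t = 1 := by
  rw [cmC, smC, ← Complex.ofReal_mul, ← Complex.ofReal_mul, ← Complex.ofReal_add, ← sq, ← sq,
    Real.cos_sq_add_sin_sq, Complex.ofReal_one]

section Pencil

variable {N c : ℕ} {x y : ℂ} {B E G P Q A1 A2 : Mat c} {C : ℕ → Mat c} {e : Fin c → ℂ}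

theorem condP1_solution (hG : IsUnit G) (hPQ : Commute P Q) (h1 : y • P + x • Q = 1)
    (hA1 : A1 = G * P) (hA2 : A2 = G * Q) (h : CondP1 (N + 1) c A1 A2 C)
    (hE : E = ∑ j ∈ Finset.range (N + 1),
      ((N.choose j : ℂ) * x ^ (N - j) * y ^ j) • (C (j + 1) * G)) :
    (∀ k ≤ N, C (k + 1) * G = Q ^ (N - k) * P ^ k * E) ∧ Commute P E ∧ Commute Q E := by
  subst hA1 hA2
  rcases N with _ | N
  · have hE' : E = C 1 * G := by simpa using hE
    refine ⟨fun k hk => ?_, commute_of_mul_mul_eq h1 ?_⟩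
    · obtain rfl : k = 0 := by omega
      simpa using hE'.symm
    · rw [CondP1, if_pos rfl] at h
      rw [hE']
      apply hG.mul_left_cancel
      simpa only [mul_assoc] using h
  · rw [CondP1, if_neg (by omega)] at h
    have hl : ∀ k < N + 1, P * (C (k + 1) * G) = Q * (C (k + 1 + 1) * G) := fun k hk => by
      apply hG.mul_left_cancel
      have := (h (k + 1) (by omega) (by omega)).1
      rw [← mul_assoc, ← mul_assoc, this, ← mul_assoc, ← mul_assoc]
    have hr : ∀ k < N + 1, C (k + 1) * G * P = C (k + 1 + 1) * G * Q := fun k hk => by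
      simpa only [mul_assoc] using (h (k + 1) (by omega) (by omega)).2
    have sl := fun k (hk : k ≤ N + 1) =>
      hPQ.pencil_solution (D := fun j => C (j + 1) * G) h1 hl hk
    have sr := fun k (hk : k ≤ N + 1) =>
      hPQ.pencil_solution_right (D := fun j => C (j + 1) * G) h1 hr hk
    rw [← hE] at sl sr
    refine ⟨sl, commute_of_commute_pencil hPQ h1 N fun a b hab => ?_⟩
    obtain rfl : a = N + 1 - b := by omega
    exact (sl b (by omega)).symm.trans (sr b (by omega))

theorem condP1_of_solution (hPQ : Commute P Q) (hPE : Commute P E) (hQE : Commute Q E)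
    (hG : IsUnit G) (hA1 : A1 = G * P) (hA2 : A2 = G * Q)
    (hC : ∀ k ≤ N, C (k + 1) * G = Q ^ (N - k) * P ^ k * E) :
    CondP1 (N + 1) c A1 A2 C := by
  subst hA1 hA2
  rw [CondP1]
  split_ifs with h
  · obtain rfl : N = 0 := by omega
    have h0 : C 1 * G = E := by simpa using hC 0 le_rfl
    have : P * E * Q = Q * E * P := by
      rw [hPE.eq, hQE.eq, mul_assoc, hPQ.eq, mul_assoc]
    calc G * P * C 1 * (G * Q) = G * (P * (C 1 * G) * Q) := by simp only [mul_assoc]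
      _ = G * (Q * (C 1 * G) * P) := by rw [h0, this]
      _ = _ := by simp only [mul_assoc]
  · intro q hq hqN
    obtain ⟨k, rfl⟩ := Nat.exists_eq_add_of_le' hq
    have e1 := hC k (by omega)
    have e2 := hC (k + 1) (by omega)
    obtain ⟨a, ha⟩ : ∃ a, N - k = a + 1 := ⟨N - k - 1, by omega⟩
    rw [ha] at e1
    rw [show N - (k + 1) = a by omega] at e2
    have key : P * (Q ^ (a + 1) * P ^ k * E) = Q * (Q ^ a * P ^ (k + 1) * E) := by
      rw [← mul_assoc, ← mul_assoc, (hPQ.pow_right (a + 1)).eq, mul_assoc (Q ^ (a + 1)),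
        ← pow_succ', pow_succ' Q]
      simp only [mul_assoc]
    constructor
    · apply hG.mul_right_cancel
      rw [mul_assoc, e1, mul_assoc G P, key, mul_assoc _ (C _) G, e2, mul_assoc G Q]
    · have c1 : Commute P (Q ^ (a + 1) * P ^ k * E) :=
        ((hPQ.pow_right _).mul_right ((Commute.refl P).pow_right _)).mul_right hPE
      have c2 : Commute Q (Q ^ a * P ^ (k + 1) * E) :=
        (((Commute.refl Q).pow_right _).mul_right (hPQ.symm.pow_right _)).mul_right hQE
      rw [← mul_assoc, ← mul_assoc, e1, e2, ← c1.eq, ← c2.eq, key]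

theorem condP3_iff_condT2 (hxy : x * x + y * y = 1) (hP : P = x • B + y • 1)
    (hQ : Q = x • 1 - y • B) (hPE : Commute P E) (hQE : Commute Q E) (hG : IsUnit G)
    (hA1 : A1 = G * P) (hA2 : A2 = G * Q)
    (hC : ∀ k ≤ N, C (k + 1) * G = Q ^ (N - k) * P ^ k * E) :
    CondP3 (N + 1) c A1 A2 C e ↔ CondT2 c B E e := by
  have hB : ∀ (v : Fin c → ℂ) (z : ℂ), B *ᵥ v = z • v →
      P *ᵥ v = (x * z + y) • v ∧ Q *ᵥ v = (x - y * z) • v := by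
    intro v z h
    rw [hP, hQ, add_mulVec, sub_mulVec, smul_mulVec, smul_mulVec, smul_mulVec, smul_mulVec,
      one_mulVec, h]
    constructor <;> module
  have hfst : C 1 * A2 = E * Q ^ (N + 1) := by
    have := hC 0 (by omega)
    rw [hA2, ← mul_assoc, this, (((hQE.pow_left (N + 1)).eq).symm : E * Q ^ (N + 1) = _)]
    rw [Nat.sub_zero, pow_zero, mul_one, mul_assoc, ← hQE.eq, ← mul_assoc, ← pow_succ]
  have hlast : C (N + 1) * A1 = E * P ^ (N + 1) := by
    have := hC N le_rfl
    rw [hA1, ← mul_assoc, this, (((hPE.pow_left (N + 1)).eq).symm : E * P ^ (N + 1) = _)]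
    rw [Nat.sub_self, pow_zero, one_mul, mul_assoc, ← hPE.eq, ← mul_assoc, ← pow_succ]
  constructor
  · rintro h z w ⟨v, hv, hz, hw, hev⟩
    obtain ⟨hp, hq⟩ := hB v z hz
    refine h (x * z + y) (-(x - y * z)) (-((x - y * z) ^ (N + 1) * w))
      ((-1) ^ (N + 1) * ((x * z + y) ^ (N + 1) * w)) ?_ ?_ ⟨v, hv, ?_, ?_, hev, ?_⟩
    · intro h0
      rw [Prod.mk.injEq, neg_eq_zero] at h0
      have : (1 : ℂ) = 0 := by linear_combination -hxy + y * h0.1 + x * h0.2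
      exact one_ne_zero this
    · rw [neg_pow (x - y * z)]
      have hs : ((-1 : ℂ) ^ (N + 1)) * (-1) ^ (N + 1) = 1 := by
        rw [← mul_pow]; simp
      linear_combination ((x - y * z) ^ (N + 1) * (x * z + y) ^ (N + 1) * w) * hs
    · rw [hfst, ← mulVec_mulVec, pow_mulVec_of_eigen hq, mulVec_smul, hw, smul_smul, neg_neg]
    · rw [hlast, ← mulVec_mulVec, pow_mulVec_of_eigen hp, mulVec_smul, hw, smul_smul,
        ← mul_assoc, ← mul_pow]
      simp
    · rw [hA1, hA2, add_mulVec, smul_mulVec, smul_mulVec, ← mulVec_mulVec, ← mulVec_mulVec, hp,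
        hq, mulVec_smul, mulVec_smul]
      module
  · rintro h l1 l2 m1 m2 hl - ⟨v, hv, hm1, hm2, hev, h0⟩
    have h0' : (l2 • P + l1 • Q) *ᵥ v = 0 := by
      apply mulVec_injective_of_isUnit hG
      rw [mulVec_mulVec, mulVec_zero, mul_add, mul_smul_comm, mul_smul_comm, ← hA1, ← hA2, h0]
    have hlin : (l2 * x - l1 * y) • (B *ᵥ v) = (-(l2 * y + l1 * x)) • v := by
      rw [hP, hQ, add_mulVec, smul_mulVec, smul_mulVec, add_mulVec, sub_mulVec, smul_mulVec,
        smul_mulVec, smul_mulVec, smul_mulVec, one_mulVec] at h0'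
      rw [← sub_eq_zero, ← h0']
      module
    have hne : l2 * x - l1 * y ≠ 0 := by
      intro hz
      rw [hz, zero_smul, eq_comm, smul_eq_zero, neg_eq_zero] at hlin
      have hz' := hlin.resolve_right hv
      apply hl
      rw [Prod.mk.injEq]
      constructor
      · linear_combination (-l1) * hxy - y * hz + x * hz'
      · linear_combination (-l2) * hxy + x * hz + y * hz'
    obtain ⟨z, hz⟩ : ∃ z : ℂ, B *ᵥ v = z • v := by
      refine ⟨(l2 * x - l1 * y)⁻¹ * -(l2 * y + l1 * x), ?_⟩
      rw [mul_smul, ← hlin, inv_smul_smul₀ hne]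
    obtain ⟨hp, hq⟩ := hB v z hz
    rw [hfst, ← mulVec_mulVec, pow_mulVec_of_eigen hq, mulVec_smul] at hm1
    rw [hlast, ← mulVec_mulVec, pow_mulVec_of_eigen hp, mulVec_smul] at hm2
    obtain ⟨w, hw⟩ : ∃ w : ℂ, E *ᵥ v = w • v := by
      by_cases hq0 : x - y * z = 0
      · have hp0 : (x * z + y) ^ (N + 1) ≠ 0 := by
          apply pow_ne_zero
          intro hp0
          have : (1 : ℂ) = 0 := by linear_combination -hxy + y * hp0 + x * hq0
          exact one_ne_zero this
        exact ⟨((x * z + y) ^ (N + 1))⁻¹ * ((-1) ^ (N + 1) * m2), by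
          rw [mul_smul, ← hm2, inv_smul_smul₀ hp0]⟩
      · exact ⟨((x - y * z) ^ (N + 1))⁻¹ * -m1, by
          rw [mul_smul, ← hm1, inv_smul_smul₀ (pow_ne_zero _ hq0)]⟩
    exact h z w ⟨v, hv, hz, hw, hev⟩

end Pencil

theorem Emat_eq_sum_range (N c : ℕ) (t : ℝ) (A1 A2 : Mat c) (C : ℕ → Mat c) :
    Emat (N + 1) c t A1 A2 C = ∑ j ∈ Finset.range (N + 1),
      ((N.choose j : ℂ) * cmC c t ^ (N - j) * smC c t ^ j) • (C (j + 1) * Amat2 c t A1 A2) := by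
  rw [Emat, Finset.sum_mul, ← Finset.Ico_add_one_right_eq_Icc, Finset.range_eq_Ico,
    ← Finset.sum_Ico_add' _ 0 (N + 1) 1]
  refine Finset.sum_congr rfl fun q _ => ?_
  rw [smul_mul_assoc, Nat.add_sub_cancel, Nat.add_sub_cancel, Nat.add_sub_add_right]

/-- The matrix `P` with `A₁ = A_{2m} P`, as a function of `B = B_m`. -/
def pencilFst (c : ℕ) (t : ℝ) (B : Mat c) : Mat c := cmC c t • B + smC c t • 1

/-- The matrix `Q` with `A₂ = A_{2m} Q`, as a function of `B = B_m`. -/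
def pencilSnd (c : ℕ) (t : ℝ) (B : Mat c) : Mat c := cmC c t • 1 - smC c t • B

theorem commute_pencil (c : ℕ) (t : ℝ) (B : Mat c) :
    Commute (pencilFst c t B) (pencilSnd c t B) := by
  rw [Commute, SemiconjBy, pencilFst, pencilSnd]
  simp only [mul_sub, sub_mul, mul_add, add_mul, smul_mul_smul_comm, mul_one, one_mul]
  module

theorem pencil_eq_one (c : ℕ) (t : ℝ) (B : Mat c) :
    smC c t • pencilFst c t B + cmC c t • pencilSnd c t B = 1 := by
  have h := cmC_sq_add_smC_sq c t
  rw [pencilFst, pencilSnd]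
  linear_combination (norm := module) h • (1 : Mat c)

theorem pencil_rotate (c : ℕ) (t : ℝ) (B : Mat c) :
    cmC c t • pencilFst c t B - smC c t • pencilSnd c t B = B := by
  have h := cmC_sq_add_smC_sq c t
  rw [pencilFst, pencilSnd]
  linear_combination (norm := module) h • B

theorem eq_Amat2_mul_pencil {c : ℕ} {t : ℝ} {A1 A2 : Mat c} (hG : IsUnit (Amat2 c t A1 A2)) :
    A1 = Amat2 c t A1 A2 * pencilFst c t (Bmat c t A1 A2) ∧
      A2 = Amat2 c t A1 A2 * pencilSnd c t (Bmat c t A1 A2) := by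
  have h := cmC_sq_add_smC_sq c t
  have hB : Amat2 c t A1 A2 * Bmat c t A1 A2 = Amat1 c t A1 A2 := by
    rw [Bmat, mul_nonsing_inv_cancel_left _ _ ((isUnit_iff_isUnit_det _).1 hG)]
  rw [pencilFst, pencilSnd, mul_add, mul_sub, mul_smul_comm, mul_smul_comm, mul_smul_comm,
    mul_smul_comm, hB, mul_one, Amat1, Amat2]
  constructor
  · linear_combination (norm := module) -h • A1
  · linear_combination (norm := module) -h • A2

theorem extC_succ {n c : ℕ} (C : Fin n → Mat c) (k : Fin n) : extC n c C (k + 1) = C k := by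
  simp [extC, k.2]

/-- the map `ζ_m : (A₁, A₂; C₁, …, Cₙ; e) ↦ (B_m, E_m, e; A_{2m})` is a
bijection from `Pⁿ(c)_m` (tuples satisfying (P1), (P2), (P3) with `A_{2m}` invertible)
onto `T(c) × GL(c, ℂ)` (triples satisfying (T1), (T2), together with an invertible matrix). -/
theorem stmt_7 (n c m : ℕ) (hn : 1 ≤ n) (hc : 1 ≤ c) (hm : m ≤ c) :
    Set.BijOn
      (fun T : Mat c × Mat c × (Fin n → Mat c) × (Fin c → ℂ) =>
        (((Bmat c m T.1 T.2.1,
           Emat n c m T.1 T.2.1 (extC n c T.2.2.1), T.2.2.2),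
          Amat2 c m T.1 T.2.1) :
          (Mat c × Mat c × (Fin c → ℂ)) × Mat c))
      {T : Mat c × Mat c × (Fin n → Mat c) × (Fin c → ℂ) |
        CondP1 n c T.1 T.2.1 (extC n c T.2.2.1) ∧
        CondP2 c T.1 T.2.1 ∧
        CondP3 n c T.1 T.2.1 (extC n c T.2.2.1) T.2.2.2 ∧
        IsUnit (Amat2 c m T.1 T.2.1)}
      {U : (Mat c × Mat c × (Fin c → ℂ)) × Mat c |
        CondT1 c U.1.1 U.1.2.1 ∧ CondT2 c U.1.1 U.1.2.1 U.1.2.2 ∧ IsUnit U.2} := by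
  obtain ⟨N, rfl⟩ := Nat.exists_eq_add_of_le' hn
  refine ⟨?_, ?_, ?_⟩
  · rintro ⟨A1, A2, C, e⟩ ⟨h1, -, h3, hG⟩
    obtain ⟨hA1, hA2⟩ := eq_Amat2_mul_pencil hG
    obtain ⟨hC, hPE, hQE⟩ := condP1_solution hG (commute_pencil c m _) (pencil_eq_one c m _)
      hA1 hA2 h1 (Emat_eq_sum_range N c m A1 A2 _)
    refine ⟨?_, (condP3_iff_condT2 (cmC_sq_add_smC_sq c m) rfl rfl hPE hQE hG hA1 hA2 hC).1 h3,
      hG⟩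
    have := (hPE.smul_left (cmC c m)).sub_left (hQE.smul_left (smC c m))
    rwa [pencil_rotate] at this
  · rintro ⟨A1, A2, C, e⟩ ⟨h1, -, -, hG⟩ ⟨A1', A2', C', e'⟩ ⟨h1', -, -, hG'⟩ heq
    obtain ⟨hA1, hA2⟩ := eq_Amat2_mul_pencil hG
    obtain ⟨hA1', hA2'⟩ := eq_Amat2_mul_pencil hG'
    obtain ⟨hC, -⟩ := condP1_solution hG (commute_pencil c m _) (pencil_eq_one c m _)
      hA1 hA2 h1 (Emat_eq_sum_range N c m A1 A2 _)
    obtain ⟨hC', -⟩ := condP1_solution hG' (commute_pencil c m _) (pencil_eq_one c m _)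
      hA1' hA2' h1' (Emat_eq_sum_range N c m A1' A2' _)
    simp only [Prod.mk.injEq] at heq hC hC' hA1 hA2 hA1' hA2' hG hG' ⊢
    obtain ⟨⟨hB, hE, he⟩, hGG⟩ := heq
    rw [hB, hGG] at hA1 hA2
    refine ⟨hA1.trans hA1'.symm, hA2.trans hA2'.symm, funext fun k => ?_, he⟩
    have hk := hC k (by omega)
    rw [hB, hE, hGG, ← hC' k (by omega)] at hk
    simpa only [extC_succ] using hG'.mul_right_cancel hk
  · rintro ⟨⟨B, E, e⟩, G⟩ ⟨h1, h2, hG⟩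
    have hG' := (isUnit_iff_isUnit_det _).1 hG
    have hBE : Commute B E := h1
    set P := pencilFst c m B with hP
    set Q := pencilSnd c m B with hQ
    have hPQ : Commute P Q := commute_pencil c m B
    have hone : smC c m • P + cmC c m • Q = 1 := pencil_eq_one c m B
    have hPE : Commute P E := (hBE.smul_left _).add_left ((Commute.one_left E).smul_left _)
    have hQE : Commute Q E := ((Commute.one_left E).smul_left _).sub_left (hBE.smul_left _)
    have hA2m : Amat2 c m (G * P) (G * Q) = G := by
      rw [Amat2, ← mul_smul_comm, ← mul_smul_comm, ← mul_add, hone, mul_one]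
    have hBm : Bmat c m (G * P) (G * Q) = B := by
      rw [Bmat, hA2m, Amat1, ← mul_smul_comm, ← mul_smul_comm, ← mul_sub, hP, hQ, pencil_rotate,
        nonsing_inv_mul_cancel_left _ _ hG']
    set C : Fin (N + 1) → Mat c := fun k => Q ^ (N - k) * P ^ (k : ℕ) * E * G⁻¹ with hCdef
    have hC : ∀ k ≤ N, extC (N + 1) c C (k + 1) * G = Q ^ (N - k) * P ^ k * E := by
      intro k hk
      rw [extC_succ C ⟨k, by omega⟩, hCdef, nonsing_inv_mul_cancel_right _ _ hG']
    have hEm : Emat (N + 1) c m (G * P) (G * Q) (extC (N + 1) c C) = E := by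
      rw [Emat_eq_sum_range, hA2m]
      conv_rhs => rw [← one_mul E, ← hPQ.sum_pencil_eq_one N hone, Finset.sum_mul]
      refine Finset.sum_congr rfl fun j hj => ?_
      rw [hC j (by simpa [Nat.lt_succ_iff] using hj), smul_mul_assoc]
    refine ⟨(G * P, G * Q, C, e), ⟨condP1_of_solution hPQ hPE hQE hG rfl rfl hC,
      ⟨smC c m, cmC c m, ?_⟩, (condP3_iff_condT2 (cmC_sq_add_smC_sq c m) hP hQ hPE hQE hG rfl rfl
        hC).2 h2, ?_⟩, ?_⟩
    · change (Amat2 c m (G * P) (G * Q)).det ≠ 0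
      rw [hA2m]
      exact hG'.ne_zero
    · change IsUnit (Amat2 c m (G * P) (G * Q))
      rwa [hA2m]
    · simp only [hBm, hEm, hA2m]
end
end

section
/- Let n ≥ 1, c ≥ 1, and let (A₁, A₂; C₁, …, Cₙ; e), with A₁, A₂, C₁, …, Cₙ ∈ End(ℂᶜ) and e ∈ Hom(ℂᶜ, ℂ), satisfy condition (P1). Then the tuple satisfies conditions (P2) and (P3) if and only if it satisfies conditions (Q2) and (Q3). -/
open Matrix BigOperators

noncomputable section

section EnhancedADHM

variable {n c : ℕ} {A1 A2 : Mat c} {C : ℕ → Mat c} {e : Fin c → ℂ}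

/-- For `n > 1`, the relations of (P1) give `C_q A₁ = C_{q+1} A₂`; for `n = 1` this is vacuous. -/
lemma CondP1.mul_eq (h : CondP1 n c A1 A2 C) {q : ℕ} (hq : 1 ≤ q) (hqn : q < n) :
    C q * A1 = C (q + 1) * A2 := by
  unfold CondP1 at h
  rw [if_neg (by omega)] at h
  exact (h q hq (by omega)).2

lemma CondP1.symm_mul (h : CondP1 n c A1 A2 C) {q : ℕ} (hq : 1 ≤ q) (hqn : q ≤ n) :
    A1 * C q * A2 = A2 * C q * A1 := by
  unfold CondP1 at h
  split_ifs at h with h1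
  · obtain rfl : q = 1 := by omega
    exact h
  · rcases hqn.lt_or_eq with hlt | rfl
    · obtain ⟨ha, hb⟩ := h q hq (by omega)
      rw [ha, mul_assoc, ← hb, mul_assoc]
    · obtain ⟨p, rfl⟩ : ∃ p, q = p + 1 := ⟨q - 1, by omega⟩
      obtain ⟨ha, hb⟩ := h p (by omega) (by omega)
      rw [← ha, mul_assoc, ← hb, mul_assoc]

/-- Any two members of the pencil spanned by `A₁` and `A₂` can be exchanged across `C_q`. -/
lemma CondP1.pencil_comm (h : CondP1 n c A1 A2 C) {q : ℕ} (hq : 1 ≤ q) (hqn : q ≤ n)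
    (a b a' b' : ℂ) :
    (a • A1 + b • A2) * C q * (a' • A1 + b' • A2) =
      (a' • A1 + b' • A2) * C q * (a • A1 + b • A2) := by
  simp only [add_mul, mul_add, smul_mul_assoc, mul_smul_comm, h.symm_mul hq hqn]
  module

/-- A nonzero invariant subspace contains an eigenvector. -/
lemma exists_eigenvector_mem (M : Mat c) {W : Submodule ℂ (Fin c → ℂ)} (hW : W ≠ ⊥)
    (hM : ∀ v ∈ W, M.mulVec v ∈ W) : ∃ μ : ℂ, ∃ v ∈ W, v ≠ 0 ∧ M.mulVec v = μ • v := by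
  have : Nontrivial W := Submodule.nontrivial_iff_ne_bot.mpr hW
  obtain ⟨μ, hμ⟩ := Module.End.exists_eigenvalue (M.mulVecLin.restrict hM)
  obtain ⟨v, hv⟩ := hμ.exists_hasEigenvector
  exact ⟨μ, v, v.2, fun h0 => hv.2 (Subtype.ext h0), congrArg Subtype.val hv.apply_eq_smul⟩

/-- A map with a kernel vector in `S` strictly lowers the dimension of `S`. -/
lemma finrank_map_lt_of_mem_ker {V : Type*} [AddCommGroup V] [Module ℂ V] [FiniteDimensional ℂ V]
    (f : V →ₗ[ℂ] V) {S : Submodule ℂ V} {v : V} (hv : v ∈ S) (hv0 : v ≠ 0) (hfv : f v = 0) :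
    Module.finrank ℂ (S.map f) < Module.finrank ℂ S := by
  have h := (f.domRestrict S).finrank_range_add_finrank_ker
  rw [LinearMap.range_domRestrict] at h
  have : Nontrivial (LinearMap.ker (f.domRestrict S)) :=
    ⟨⟨⟨⟨v, hv⟩, by simpa using hfv⟩, 0, fun h0 => hv0 (by simpa using h0)⟩⟩
  have := Module.finrank_pos (R := ℂ) (M := LinearMap.ker (f.domRestrict S))
  omega

/-- If every sub-representation satisfies `dim S₀ ≤ dim S₁`, then the pencil is regular. -/
lemma condP2_of_forall_subRep (hP1 : CondP1 n c A1 A2 C)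
    (hQ : ∀ S0 S1 : Submodule ℂ (Fin c → ℂ), SubRep n c A1 A2 C S0 S1 →
      Module.finrank ℂ S0 ≤ Module.finrank ℂ S1) : CondP2 c A1 A2 := by
  by_contra hP2
  unfold CondP2 at hP2
  push Not at hP2
  set P : ℕ → Mat c := fun j => (1 : ℂ) • A1 + (j : ℂ) • A2 with hP
  let S : ℕ →o Submodule ℂ (Fin c → ℂ) :=
    ⟨fun k => ⨆ j, ⨆ _ : j < k, LinearMap.ker (P j).mulVecLin, fun a b hab =>
      iSup_mono fun j => iSup_mono' fun hj => ⟨hj.trans_le hab, le_rfl⟩⟩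
  obtain ⟨k, hk⟩ := monotone_stabilizes_iff_noetherian.mpr
    (inferInstance : IsNoetherian ℂ (Fin c → ℂ)) S
  have hker : LinearMap.ker (P k).mulVecLin ≤ S k := by
    rw [hk (k + 1) (by omega)]
    exact le_iSup₂_of_le k (by omega) le_rfl
  obtain ⟨v, hv0, hv⟩ := Matrix.exists_mulVec_eq_zero_iff.mpr (hP2 1 k)
  refine absurd (hQ (S k) ((S k).map (P k).mulVecLin) ⟨fun w hw => ?_, ?_⟩)
    (not_le.mpr (finrank_map_lt_of_mem_ker (P k).mulVecLin (hker hv) hv0 hv))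
  · suffices S k ≤ ((S k).map (P k).mulVecLin).comap A1.mulVecLin ⊓
      ((S k).map (P k).mulVecLin).comap A2.mulVecLin from this hw
    refine iSup₂_le fun j hj w hw => ?_
    have hwS : w ∈ S k := (le_iSup₂_of_le j hj le_rfl : LinearMap.ker (P j).mulVecLin ≤ S k) hw
    have hw1 : A1.mulVec w = -((j : ℂ) • A2.mulVec w) := by
      have : (P j).mulVec w = 0 := hw
      simp only [hP, add_mulVec, smul_mulVec, one_smul] at this
      exact eq_neg_of_add_eq_zero_left this
    have hkj : (k : ℂ) - j ≠ 0 := sub_ne_zero.mpr (by exact_mod_cast hj.ne')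
    have h2 : A2.mulVec w ∈ (S k).map (P k).mulVecLin := by
      refine ⟨((k : ℂ) - j)⁻¹ • w, (S k).smul_mem _ hwS, ?_⟩
      have : (P k).mulVec w = ((k : ℂ) - j) • A2.mulVec w := by
        simp only [hP, add_mulVec, smul_mulVec, one_smul, hw1]
        module
      rw [map_smul, mulVecLin_apply, this, inv_smul_smul₀ hkj]
    refine ⟨?_, h2⟩
    change A1.mulVec w ∈ (S k).map (P k).mulVecLin
    rw [hw1]
    exact Submodule.neg_mem _ (Submodule.smul_mem _ _ h2)
  · rintro _ ⟨w, hw, rfl⟩ q hq hqn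
    suffices S k ≤ (S k).comap (C q * P k).mulVecLin by
      simpa [mulVec_mulVec] using this hw
    refine iSup₂_le fun j hj w hw => ?_
    refine (le_iSup₂_of_le j hj le_rfl : LinearMap.ker (P j).mulVecLin ≤ S k) ?_
    have hw' : (P j).mulVec w = 0 := hw
    change (P j).mulVec ((C q * P k).mulVec w) = 0
    rw [mulVec_mulVec, ← mul_assoc, hP1.pencil_comm hq hqn, ← mulVec_mulVec, hw', mulVec_zero]

/-- Condition (Q2) implies (P3): a vector violating (P3) spans, together with its images, a
sub-representation violating (Q2). -/
lemma condP3_of_condQ2 (hP1 : CondP1 n c A1 A2 C) (hQ2 : CondQ2 n c A1 A2 C e) :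
    CondP3 n c A1 A2 C e := by
  rintro l1 l2 m1 m2 hl - ⟨v, hv0, hv1, hvn, hev, hlv⟩
  rw [← mulVec_mulVec] at hv1 hvn
  have hstep : ∀ q, 1 ≤ q → q < n →
      (C q).mulVec (A1.mulVec v) = (C (q + 1)).mulVec (A2.mulVec v) := fun q hq hqn => by
    rw [mulVec_mulVec, mulVec_mulVec, hP1.mul_eq hq hqn]
  have hspan1 : (C 1).mulVec (A2.mulVec v) ∈ ℂ ∙ v := hv1 ▸
    Submodule.smul_mem _ _ (Submodule.mem_span_singleton_self v)
  have hspann : (C n).mulVec (A1.mulVec v) ∈ ℂ ∙ v := hvn ▸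
    Submodule.smul_mem _ _ (Submodule.mem_span_singleton_self v)
  rw [add_mulVec, smul_mulVec, smul_mulVec] at hlv
  obtain ⟨u, hu1, hu2, hCu⟩ : ∃ u, A1.mulVec v ∈ ℂ ∙ u ∧ A2.mulVec v ∈ ℂ ∙ u ∧
      ∀ q, 1 ≤ q → q ≤ n → (C q).mulVec u ∈ ℂ ∙ v := by
    by_cases h2 : l2 = 0
    · have h1 : l1 ≠ 0 := fun h1 => hl (by rw [h1, h2])
      have hA2 : A2.mulVec v = 0 := by simpa [h2, h1] using hlv
      refine ⟨A1.mulVec v, Submodule.mem_span_singleton_self _, by simp [hA2],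
        fun q hq hqn => ?_⟩
      rcases hqn.lt_or_eq with hlt | rfl
      · simp [hstep q hq hlt, hA2]
      · exact hspann
    · have hA1 : A1.mulVec v = (-(l2⁻¹ * l1)) • A2.mulVec v := by
        rw [← inv_smul_smul₀ h2 (A1.mulVec v), eq_neg_of_add_eq_zero_left hlv]
        module
      refine ⟨A2.mulVec v, Submodule.mem_span_singleton.mpr ⟨_, hA1.symm⟩,
        Submodule.mem_span_singleton_self _, fun q hq => ?_⟩
      induction q, hq using Nat.le_induction with
      | base => exact fun _ => hspan1
      | succ q hq ih =>
        intro hqn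
        rw [← hstep q hq hqn, hA1, mulVec_smul]
        exact Submodule.smul_mem _ _ (ih (by omega))
  have key := hQ2 (ℂ ∙ v) (ℂ ∙ u) ⟨?_, ?_⟩ ?_
  · have hle : Module.finrank ℂ (ℂ ∙ u) ≤ 1 := by
      simpa using finrank_span_le_card (R := ℂ) ({u} : Set (Fin c → ℂ))
    have h1 := finrank_span_singleton (K := ℂ) hv0
    have hbot := (key.2 (by have := key.1; omega)).1
    exact hv0 (Submodule.span_singleton_eq_bot.mp hbot)
  · intro w hw
    obtain ⟨a, rfl⟩ := Submodule.mem_span_singleton.mp hw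
    simp only [mulVec_smul]
    exact ⟨Submodule.smul_mem _ _ hu1, Submodule.smul_mem _ _ hu2⟩
  · intro w hw q hq hqn
    obtain ⟨a, rfl⟩ := Submodule.mem_span_singleton.mp hw
    rw [mulVec_smul]
    exact Submodule.smul_mem _ _ (hCu q hq hqn)
  · intro w hw
    obtain ⟨a, rfl⟩ := Submodule.mem_span_singleton.mp hw
    rw [dotProduct_smul, hev, smul_zero]

/-- The simultaneous relative eigenspace inside `S₀` of `A₁` and `A₂` with respect to `A`. -/
def relEigenspace (A A1 A2 : Mat c) (S0 : Submodule ℂ (Fin c → ℂ)) (α β : ℂ) :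
    Submodule ℂ (Fin c → ℂ) :=
  S0 ⊓ LinearMap.ker (A1 - α • A).mulVecLin ⊓ LinearMap.ker (A2 - β • A).mulVecLin

lemma mem_relEigenspace {A : Mat c} {S0 : Submodule ℂ (Fin c → ℂ)} {α β : ℂ} {v : Fin c → ℂ} :
    v ∈ relEigenspace A A1 A2 S0 α β ↔
      v ∈ S0 ∧ A1.mulVec v = α • A.mulVec v ∧ A2.mulVec v = β • A.mulVec v := by
  simp [relEigenspace, sub_eq_zero, and_assoc]

/-- If `A = ν₁A₁ + ν₂A₂` is invertible and maps `S₀` onto `S₁`, then `A₁` and `A₂` have a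
simultaneous relative eigenvector in `S₀`. -/
lemma exists_relEigenspace_ne_bot {ν1 ν2 : ℂ} (hdet : (ν1 • A1 + ν2 • A2).det ≠ 0)
    {S0 : Submodule ℂ (Fin c → ℂ)} (hS0 : S0 ≠ ⊥)
    (hA1 : ∀ v ∈ S0, A1.mulVec v ∈ S0.map (ν1 • A1 + ν2 • A2).mulVecLin)
    (hA2 : ∀ v ∈ S0, A2.mulVec v ∈ S0.map (ν1 • A1 + ν2 • A2).mulVecLin) :
    ∃ α β : ℂ, relEigenspace (ν1 • A1 + ν2 • A2) A1 A2 S0 α β ≠ ⊥ := by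
  set A := ν1 • A1 + ν2 • A2 with hA
  have hu : IsUnit A.det := isUnit_iff_ne_zero.mpr hdet
  have hpres : ∀ {M : Mat c}, (∀ v ∈ S0, M.mulVec v ∈ S0.map A.mulVecLin) →
      ∃ μ : ℂ, ∃ v ∈ S0, v ≠ 0 ∧ M.mulVec v = μ • A.mulVec v := by
    intro M hM
    obtain ⟨μ, v, hv, hv0, hμ⟩ := exists_eigenvector_mem (A⁻¹ * M) hS0 fun v hv => by
      obtain ⟨w, hw, hwv⟩ := hM v hv
      rw [← mulVec_mulVec, ← hwv, mulVecLin_apply, mulVec_mulVec, nonsing_inv_mul _ hu,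
        one_mulVec]
      exact hw
    refine ⟨μ, v, hv, hv0, ?_⟩
    rw [← mulVec_smul, ← hμ, mulVec_mulVec, ← mul_assoc, mul_nonsing_inv _ hu, one_mul]
  by_cases h2 : ν2 = 0
  · have h1 : ν1 ≠ 0 := by
      rintro rfl
      obtain ⟨v, hv, hv0⟩ := S0.exists_mem_ne_zero_of_ne_bot hS0
      refine hdet (Matrix.exists_mulVec_eq_zero_iff.mp ⟨v, hv0, ?_⟩)
      simp [hA, h2]
    obtain ⟨μ, v, hv, hv0, hμ⟩ := hpres hA2
    refine ⟨ν1⁻¹, μ, fun hbot => hv0 ?_⟩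
    rw [← Submodule.mem_bot ℂ, ← hbot, mem_relEigenspace]
    refine ⟨hv, ?_, hμ⟩
    rw [hA, h2, zero_smul, add_zero, smul_mulVec, inv_smul_smul₀ h1]
  · obtain ⟨μ, v, hv, hv0, hμ⟩ := hpres hA1
    refine ⟨μ, ν2⁻¹ * (1 - ν1 * μ), fun hbot => hv0 ?_⟩
    rw [← Submodule.mem_bot ℂ, ← hbot, mem_relEigenspace]
    refine ⟨hv, hμ, ?_⟩
    have hAv : A.mulVec v = ν1 • A1.mulVec v + ν2 • A2.mulVec v := by
      rw [hA, add_mulVec, smul_mulVec, smul_mulVec]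
    have : ν2 • A2.mulVec v = (1 - ν1 * μ) • A.mulVec v := by
      rw [eq_sub_of_add_eq' hAv.symm, hμ]
      module
    rw [mul_smul, ← this, inv_smul_smul₀ h2]

/-- Under (P1), the operators `C_q A` preserve the relative eigenspaces. -/
lemma CondP1.mulVec_mem_relEigenspace (hP1 : CondP1 n c A1 A2 C) {ν1 ν2 α β : ℂ}
    {S0 S1 : Submodule ℂ (Fin c → ℂ)} (hS : SubRep n c A1 A2 C S0 S1) {q : ℕ} (hq : 1 ≤ q)
    (hqn : q ≤ n) {v : Fin c → ℂ}
    (hv : v ∈ relEigenspace (ν1 • A1 + ν2 • A2) A1 A2 S0 α β) :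
    (C q * (ν1 • A1 + ν2 • A2)).mulVec v ∈
      relEigenspace (ν1 • A1 + ν2 • A2) A1 A2 S0 α β := by
  rw [mem_relEigenspace] at hv ⊢
  obtain ⟨hv0, hv1, hv2⟩ := hv
  have hc1 : A1 * C q * (ν1 • A1 + ν2 • A2) = (ν1 • A1 + ν2 • A2) * C q * A1 := by
    simpa using hP1.pencil_comm hq hqn 1 0 ν1 ν2
  have hc2 : A2 * C q * (ν1 • A1 + ν2 • A2) = (ν1 • A1 + ν2 • A2) * C q * A2 := by
    simpa using hP1.pencil_comm hq hqn 0 1 ν1 ν2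
  refine ⟨?_, ?_, ?_⟩
  · rw [← mulVec_mulVec]
    refine hS.2 _ ?_ q hq hqn
    rw [add_mulVec, smul_mulVec, smul_mulVec]
    exact add_mem (S1.smul_mem _ (hS.1 v hv0).1) (S1.smul_mem _ (hS.1 v hv0).2)
  · rw [mulVec_mulVec, ← mul_assoc, hc1, ← mulVec_mulVec, hv1, mulVec_smul, mulVec_mulVec,
      mulVec_mulVec, ← mul_assoc]
  · rw [mulVec_mulVec, ← mul_assoc, hc2, ← mulVec_mulVec, hv2, mulVec_smul, mulVec_mulVec,
      mulVec_mulVec, ← mul_assoc]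

/-- Under (P1) and (P3), a sub-representation with `S₀ ⊆ ker e` such that an invertible member
of the pencil maps `S₀` onto `S₁` is zero: otherwise it contains a vector violating (P3). -/
lemma CondP3.subRep_eq_bot (hn : 1 ≤ n) (hP1 : CondP1 n c A1 A2 C)
    (hP3 : CondP3 n c A1 A2 C e) {ν1 ν2 : ℂ} (hdet : (ν1 • A1 + ν2 • A2).det ≠ 0)
    {S0 S1 : Submodule ℂ (Fin c → ℂ)} (hS : SubRep n c A1 A2 C S0 S1)
    (he : ∀ v ∈ S0, e ⬝ᵥ v = 0) (hmap : S0.map (ν1 • A1 + ν2 • A2).mulVecLin = S1) :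
    S0 = ⊥ := by
  by_contra hS0
  obtain ⟨α, β, hW⟩ := exists_relEigenspace_ne_bot hdet hS0
    (fun v hv => hmap ▸ (hS.1 v hv).1) (fun v hv => hmap ▸ (hS.1 v hv).2)
  have hinv := fun q hq hqn v hv =>
    hP1.mulVec_mem_relEigenspace (ν1 := ν1) (ν2 := ν2) (α := α) (β := β) (q := q) (v := v)
      hS hq hqn hv
  have hAeq : ∀ v, (ν1 • A1 + ν2 • A2).mulVec v = ν1 • A1.mulVec v + ν2 • A2.mulVec v :=
    fun v => by rw [add_mulVec, smul_mulVec, smul_mulVec]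
  set A := ν1 • A1 + ν2 • A2
  have hl : (-α, β) ≠ (0, 0) := by
    intro h
    obtain ⟨v, hv, hv0⟩ := Submodule.exists_mem_ne_zero_of_ne_bot hW
    obtain ⟨-, hv1, hv2⟩ := mem_relEigenspace.mp hv
    obtain ⟨h1, rfl⟩ := Prod.mk.inj h
    obtain rfl := neg_eq_zero.mp h1
    refine hdet (Matrix.exists_mulVec_eq_zero_iff.mp ⟨v, hv0, ?_⟩)
    rw [hAeq, hv1, hv2]
    simp
  have hlv : ∀ v ∈ relEigenspace A A1 A2 S0 α β, (β • A1 + (-α) • A2).mulVec v = 0 := by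
    intro v hv
    obtain ⟨-, hv1, hv2⟩ := mem_relEigenspace.mp hv
    rw [add_mulVec, smul_mulVec, smul_mulVec, hv1, hv2]
    module
  by_cases hβ : β = 0
  · obtain ⟨y, v, hv, hv0, hy⟩ := exists_eigenvector_mem _ hW (hinv n hn le_rfl)
    obtain ⟨hvS, hv1, hv2⟩ := mem_relEigenspace.mp hv
    refine hP3 (-α) β 0 ((-1) ^ n * (α * y)) hl (by simp [hβ, Nat.ne_of_gt hn])
      ⟨v, hv0, ?_, ?_, he v hvS, hlv v hv⟩
    · simp [← mulVec_mulVec, hv2, hβ]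
    · rw [← mulVec_mulVec, hv1, mulVec_smul, mulVec_mulVec, hy, smul_smul, ← mul_assoc,
        ← mul_pow]
      simp
  · obtain ⟨x, v, hv, hv0, hx⟩ := exists_eigenvector_mem _ hW (hinv 1 le_rfl hn)
    obtain ⟨hvS, hv1, hv2⟩ := mem_relEigenspace.mp hv
    have hq : ∀ q, q < n → (C (q + 1) * A).mulVec v = ((α / β) ^ q * x) • v := by
      intro q
      induction q with
      | zero => simpa using fun _ => hx
      | succ q ih =>
        intro hqn
        have h := congrArg (fun M => M.mulVec v) (hP1.mul_eq (q := q + 1) (by omega) hqn)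
        simp only [← mulVec_mulVec, hv1, hv2, mulVec_smul] at h
        rw [mulVec_mulVec, mulVec_mulVec, ih (by omega)] at h
        rw [← inv_smul_smul₀ hβ ((C (q + 1 + 1) * A).mulVec v), ← h, smul_smul, smul_smul]
        congr 1
        rw [pow_succ]
        field_simp
    obtain ⟨m, rfl⟩ : ∃ m, n = m + 1 := ⟨n - 1, by omega⟩
    refine hP3 (-α) β (-(β * x)) ((-1) ^ (m + 1) * (α * ((α / β) ^ m * x))) hl ?_
      ⟨v, hv0, ?_, ?_, he v hvS, hlv v hv⟩
    · rw [neg_pow α, div_pow]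
      field_simp
      ring
    · rw [← mulVec_mulVec, hv2, mulVec_smul, mulVec_mulVec, hx, smul_smul, neg_neg]
    · rw [← mulVec_mulVec, hv1, mulVec_smul, mulVec_mulVec, hq m (by omega), smul_smul,
        ← mul_assoc ((-1 : ℂ) ^ (m + 1)), ← mul_pow]
      simp

end EnhancedADHM

/-- under (P1), conditions (P2) and (P3) hold iff conditions (Q2) and (Q3)
hold (here (Q3), with no framing maps, says `dim S₀ ≤ dim S₁` for every sub-representation). -/
theorem stmt_10 (n c : ℕ) (hn : 1 ≤ n) (hc : 1 ≤ c) (A1 A2 : Mat c)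
    (C : ℕ → Mat c) (e : Fin c → ℂ) (hP1 : CondP1 n c A1 A2 C) :
    (CondP2 c A1 A2 ∧ CondP3 n c A1 A2 C e) ↔
      (CondQ2 n c A1 A2 C e ∧
        ∀ S0 S1 : Submodule ℂ (Fin c → ℂ), SubRep n c A1 A2 C S0 S1 →
          Module.finrank ℂ S0 ≤ Module.finrank ℂ S1) := by
  refine ⟨fun ⟨⟨ν1, ν2, hdet⟩, hP3⟩ => ?_, fun ⟨hQ2, hQ3⟩ =>
    ⟨condP2_of_forall_subRep hP1 hQ3, condP3_of_condQ2 hP1 hQ2⟩⟩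
  have hinj : Function.Injective (ν1 • A1 + ν2 • A2).mulVecLin :=
    mulVec_injective_iff_isUnit.mpr ((isUnit_iff_isUnit_det _).mpr (isUnit_iff_ne_zero.mpr hdet))
  have hle : ∀ S0 S1 : Submodule ℂ (Fin c → ℂ), SubRep n c A1 A2 C S0 S1 →
      S0.map (ν1 • A1 + ν2 • A2).mulVecLin ≤ S1 := by
    rintro S0 S1 hS _ ⟨v, hv, rfl⟩
    rw [mulVecLin_apply, add_mulVec, smul_mulVec, smul_mulVec]
    exact add_mem (S1.smul_mem _ (hS.1 v hv).1) (S1.smul_mem _ (hS.1 v hv).2)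
  have hrank : ∀ S0 : Submodule ℂ (Fin c → ℂ),
      Module.finrank ℂ (S0.map (ν1 • A1 + ν2 • A2).mulVecLin) = Module.finrank ℂ S0 :=
    fun S0 => (Submodule.equivMapOfInjective _ hinj S0).symm.finrank_eq
  have hQ3 : ∀ S0 S1 : Submodule ℂ (Fin c → ℂ), SubRep n c A1 A2 C S0 S1 →
      Module.finrank ℂ S0 ≤ Module.finrank ℂ S1 := fun S0 S1 hS =>
    hrank S0 ▸ Submodule.finrank_mono (hle S0 S1 hS)
  refine ⟨fun S0 S1 hS he => ⟨hQ3 S0 S1 hS, fun heq => ?_⟩, hQ3⟩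
  have hmap : S0.map (ν1 • A1 + ν2 • A2).mulVecLin = S1 :=
    Submodule.eq_of_le_of_finrank_eq (hle S0 S1 hS) ((hrank S0).trans heq)
  have hbot := hP3.subRep_eq_bot hn hP1 hdet hS he hmap
  exact ⟨hbot, by rw [← hmap, hbot, Submodule.map_bot]⟩
end
end

section
/- Let n ≥ 1, c ≥ 1, and let (A₁, A₂; C₁, …, Cₙ; e; f₁, …, f_{n−1}), with A₁, A₂, C₁, …, Cₙ ∈ End(ℂᶜ), e ∈ Hom(ℂᶜ, ℂ) and f₁, …, f_{n−1} ∈ Hom(ℂ, ℂᶜ), satisfy conditions (Q1), (Q2) and (Q3). Then ker A₁ ∩ ker A₂ = {0}. -/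
open Matrix BigOperators

noncomputable section

/-- under conditions (Q1), (Q2), (Q3), `ker A₁ ∩ ker A₂ = {0}`. -/
theorem stmt_11 (n c : ℕ) (hn : 1 ≤ n) (hc : 1 ≤ c) (A1 A2 : Mat c)
    (C : ℕ → Mat c) (e : Fin c → ℂ) (f : ℕ → Fin c → ℂ)
    (hQ1 : CondQ1 n c A1 A2 C e f) (hQ2 : CondQ2 n c A1 A2 C e)
    (hQ3 : CondQ3 n c A1 A2 C f) :
    ∀ v : Fin c → ℂ, A1.mulVec v = 0 → A2.mulVec v = 0 → v = 0 := by
  intro v h1 h2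
  by_contra hv
  have hsub : SubRep n c A1 A2 C (Submodule.span ℂ {v}) ⊥ := by
    refine ⟨fun w hw => ?_, fun w hw q _ _ => ?_⟩
    · obtain ⟨a, rfl⟩ := Submodule.mem_span_singleton.mp hw
      simp [mulVec_smul, h1, h2]
    · rw [(Submodule.mem_bot ℂ).mp hw, mulVec_zero]
      exact Submodule.zero_mem _
  have hdim : ¬ Module.finrank ℂ (Submodule.span ℂ {v}) ≤
      Module.finrank ℂ (⊥ : Submodule ℂ (Fin c → ℂ)) := by
    rw [finrank_span_singleton hv, finrank_bot]
    norm_num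
  by_cases he : e ⬝ᵥ v = 0
  · refine hdim (hQ2 _ _ hsub fun w hw => ?_).1
    obtain ⟨a, rfl⟩ := Submodule.mem_span_singleton.mp hw
    simp [he]
  · refine hdim (hQ3 _ _ hsub fun i hi hin => ?_)
    rw [CondQ1, if_neg (by omega)] at hQ1
    have h := congrArg (fun M => M.mulVec v) (hQ1 i hi hin).2
    simp only [add_mulVec, ← mulVec_mulVec, h1, h2, mulVec_zero, zero_add] at h
    have hf : f i = 0 := by
      ext j
      have hj := congrFun h j
      simpa [vecMulVec_mulVec, he] using hj
    rw [hf]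
    exact Submodule.zero_mem _
end
end

section
/- Let n ≥ 2, c ≥ 1, and let (A₁, A₂; C₁, …, Cₙ; e; f₁, …, f_{n−1}), with A₁, A₂, C₁, …, Cₙ ∈ End(ℂᶜ), e ∈ Hom(ℂᶜ, ℂ) and f₁, …, f_{n−1} ∈ Hom(ℂ, ℂᶜ), satisfy conditions (Q1), (Q2) and (Q3), and in addition condition (P2): there exists (ν₁, ν₂) ∈ ℂ² with det(ν₁A₁ + ν₂A₂) ≠ 0. Then f₁ = f₂ = … = f_{n−1} = 0. -/
open Matrix BigOperators

noncomputable section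

/-- The matrix of a word in two letters, `true` standing for `X` and `false` for `Y`. -/
def wordMat {c : ℕ} (X Y : Mat c) (w : List Bool) : Mat c :=
  (w.map fun b => if b then X else Y).prod

section Words

variable {c : ℕ} {X Y K : Mat c}

lemma wordMat_append (u v : List Bool) :
    wordMat X Y (u ++ v) = wordMat X Y u * wordMat X Y v := by
  simp [wordMat]

lemma wordMat_cons (b : Bool) (v : List Bool) :
    wordMat X Y (b :: v) = (if b then X else Y) * wordMat X Y v := by
  simp [wordMat]

lemma wordMat_replicate_true (k : ℕ) : wordMat X Y (List.replicate k true) = X ^ k := by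
  simp [wordMat]

lemma wordMat_replicate_false (k : ℕ) : wordMat X Y (List.replicate k false) = Y ^ k := by
  simp [wordMat]

/-- If the traces against the commutator vanish on short words, then on words of the next length
they do not depend on the order of the letters. -/
lemma trace_wordMat_mul_eq_of_perm (hK : X * Y - Y * X = K)
    (hrank : ∀ P Q : Mat c, (P * K * Q * K).trace = (P * K).trace * (Q * K).trace) {N : ℕ}
    (ih : ∀ w : List Bool, w.length < N → (wordMat X Y w * K).trace = 0)
    {l₁ l₂ : List Bool} (h : l₁.Perm l₂) :
    ∀ u : List Bool, (u ++ l₁).length = N →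
      (wordMat X Y (u ++ l₁) * K).trace = (wordMat X Y (u ++ l₂) * K).trace := by
  induction h with
  | nil => intro u _; rfl
  | @cons x l₁ l₂ _ ih' =>
    intro u hu
    simpa using ih' (u ++ [x]) (by simpa using hu)
  | swap x y l =>
    intro u hu
    have h0 := hrank (wordMat X Y u) (wordMat X Y l)
    rw [ih u (by simp at hu; omega), zero_mul] at h0
    subst hK
    simp only [wordMat_append, wordMat_cons]
    rcases x with _ | _ <;> rcases y with _ | _ <;> simp only [if_true, if_false, Bool.false_eq_true]
    · rw [← sub_eq_zero, ← Matrix.trace_sub, ← h0]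
      congr 1
      noncomm_ring
    · rw [← sub_eq_zero, ← neg_eq_zero, ← Matrix.trace_sub, ← Matrix.trace_neg, ← h0]
      congr 1
      noncomm_ring
  | trans h₁ _ ih₁ ih₂ =>
    intro u hu
    rw [ih₁ u hu, ih₂ u (by simpa [h₁.length_eq] using hu)]

/-- If the commutator `K` of `X` and `Y` behaves like a rank one matrix under traces, then every
word in `X` and `Y` has zero trace against `K`. -/
lemma trace_wordMat_mul_eq_zero (hK : X * Y - Y * X = K)
    (hrank : ∀ P Q : Mat c, (P * K * Q * K).trace = (P * K).trace * (Q * K).trace)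
    (w : List Bool) : (wordMat X Y w * K).trace = 0 := by
  induction hN : w.length using Nat.strong_induction_on generalizing w with
  | _ N ih =>
  subst hN
  have ih' : ∀ v : List Bool, v.length < w.length → (wordMat X Y v * K).trace = 0 :=
    fun v hv => ih _ hv v rfl
  have perm : ∀ v : List Bool, v.Perm w →
      (wordMat X Y v * K).trace = (wordMat X Y w * K).trace := fun v hv => by
    simpa using trace_wordMat_mul_eq_of_perm hK hrank ih' hv [] (by simpa using hv.length_eq)
  set k := w.count true
  set l := w.count false
  have hw : (List.replicate k true ++ List.replicate l false).Perm w := by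
    rw [List.perm_iff_count]
    intro b
    cases b <;> simp [List.count_replicate, k, l]
  have key : ∀ j i : ℕ, j + i = l →
      (X ^ k * (Y ^ j * X - X * Y ^ j) * Y ^ (i + 1)).trace =
        -(j : ℂ) * (wordMat X Y w * K).trace := by
    intro j
    induction j with
    | zero => intro i _; simp
    | succ j ihj =>
      intro i hi
      have e1 : X ^ k * (Y ^ (j + 1) * X - X * Y ^ (j + 1)) * Y ^ (i + 1) =
          X ^ k * (Y ^ j * X - X * Y ^ j) * Y ^ (i + 1 + 1) - X ^ k * Y ^ j * K * Y ^ (i + 1) := by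
        rw [← hK, pow_succ Y j, pow_succ' Y (i + 1)]
        noncomm_ring
      have e2 : (X ^ k * Y ^ j * K * Y ^ (i + 1)).trace = (wordMat X Y w * K).trace := by
        rw [Matrix.trace_mul_comm, ← perm (List.replicate (i + 1) false ++
          (List.replicate k true ++ List.replicate j false))]
        · simp only [wordMat_append, wordMat_replicate_true, wordMat_replicate_false, mul_assoc]
        · refine List.Perm.trans ?_ hw
          rw [List.perm_iff_count]
          intro b
          cases b <;> simp [List.count_replicate]
          omega
      rw [e1, Matrix.trace_sub, e2, ihj (i + 1) (by omega)]
      push_cast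
      ring
  have h1 : (wordMat X Y w * K).trace = -(l : ℂ) * (wordMat X Y w * K).trace := by
    rw [← key l 0 rfl, ← perm _ hw, wordMat_append, wordMat_replicate_true,
      wordMat_replicate_false]
    have e1 : X ^ k * Y ^ l * K =
        X ^ k * (Y ^ l * X - X * Y ^ l) * Y ^ (0 + 1) +
          (X * (X ^ k * Y ^ (l + 1)) - X ^ k * Y ^ (l + 1) * X) := by
      rw [← hK, pow_succ Y l, ← mul_assoc X (X ^ k), ← pow_succ', pow_succ X k]
      noncomm_ring
    rw [e1, Matrix.trace_add, Matrix.trace_sub, Matrix.trace_mul_comm X, sub_self, add_zero]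
  have h2 : ((l : ℂ) + 1) * (wordMat X Y w * K).trace = 0 := by linear_combination h1
  exact (mul_eq_zero.mp h2).resolve_left (Nat.cast_add_one_ne_zero l)

end Words

/-- A chain `P * D q = Q * D (q + 1)` of length `m + 1`, where `1` is a combination of `P`
and `Q`, consists of the multiples `P ^ q * Q ^ (m - q) * E` of one element. -/
lemma exists_eq_pow_mul_pow_mul {R : Type*} [Ring R] [Algebra ℂ R] {P Q : R} {s t : ℂ}
    (h1 : s • P + t • Q = 1) (m : ℕ) (D : ℕ → R)
    (hD : ∀ q < m, P * D q = Q * D (q + 1)) :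
    ∃ E : R, ∀ q ≤ m, D q = P ^ q * Q ^ (m - q) * E := by
  induction m generalizing D with
  | zero =>
    refine ⟨D 0, fun q hq => ?_⟩
    obtain rfl : q = 0 := by omega
    simp
  | succ m ih =>
    obtain ⟨E, hE⟩ := ih (fun q => t • D q + s • D (q + 1)) (fun q hq => by
      simp only [mul_add, mul_smul_comm]
      rw [hD q (by omega), hD (q + 1) (by omega)])
    have hQ : ∀ q ≤ m, D q = Q * (t • D q + s • D (q + 1)) := fun q hq => by
      rw [mul_add, mul_smul_comm, mul_smul_comm, ← hD q (by omega), ← smul_mul_assoc,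
        ← smul_mul_assoc, ← add_mul, add_comm (t • Q), h1, one_mul]
    have hP : ∀ q ≤ m, D (q + 1) = P * (t • D q + s • D (q + 1)) := fun q hq => by
      rw [mul_add, mul_smul_comm, mul_smul_comm, hD q (by omega), ← smul_mul_assoc,
        ← smul_mul_assoc, ← add_mul, add_comm (t • Q), h1, one_mul]
    refine ⟨E, fun q hq => ?_⟩
    rcases q with _ | q
    · rw [hQ 0 (by omega), hE 0 (by omega)]
      simp [pow_succ', mul_assoc]
    · rw [hP q (by omega), hE q (by omega), Nat.add_sub_add_right]
      simp [pow_succ', mul_assoc]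

/-- An element all of whose multiples by the monomials of degree `m` in `P`, `Q` lie in a
submodule lies in it, as soon as `1` is a combination of the commuting elements `P`, `Q`. -/
lemma mem_of_pow_mul_pow_mul_mem {R : Type*} [Ring R] [Algebra ℂ R] {P Q : R} {s t : ℂ}
    (hPQ : Commute P Q) (h1 : s • P + t • Q = 1) (S : Submodule ℂ R) (m : ℕ) (X : R)
    (h : ∀ q ≤ m, P ^ q * Q ^ (m - q) * X ∈ S) : X ∈ S := by
  induction m generalizing X with
  | zero => simpa using h 0 le_rfl
  | succ m ih =>
    have hP : P * X ∈ S := ih _ fun q hq => by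
      have := h (q + 1) (by omega)
      rwa [Nat.add_sub_add_right, pow_succ, mul_assoc (P ^ q), (hPQ.pow_right _).eq,
        ← mul_assoc, mul_assoc] at this
    have hQ : Q * X ∈ S := ih _ fun q hq => by
      have := h q (by omega)
      rwa [Nat.sub_add_comm hq, pow_succ, ← mul_assoc, mul_assoc] at this
    rw [← one_mul X, ← h1, add_mul, smul_mul_assoc, smul_mul_assoc]
    exact S.add_mem (S.smul_mem _ hP) (S.smul_mem _ hQ)

/-- The largest subspace of `ker e` stable under `X` and `Y`. -/
def costableCore {c : ℕ} (X Y : Mat c) (e : Fin c → ℂ) : Submodule ℂ (Fin c → ℂ) where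
  carrier := {v | ∀ w : List Bool, e ⬝ᵥ (wordMat X Y w).mulVec v = 0}
  add_mem' ha hb w := by simp [Matrix.mulVec_add, ha w, hb w]
  zero_mem' w := by simp
  smul_mem' a v hv w := by simp [Matrix.mulVec_smul, hv w]

section Core

variable {c : ℕ} {X Y : Mat c} {e : Fin c → ℂ}

lemma costableCore_le_ker {v : Fin c → ℂ} (hv : v ∈ costableCore X Y e) : e ⬝ᵥ v = 0 := by
  simpa [wordMat] using hv []

lemma mulVec_left_mem_costableCore {v : Fin c → ℂ} (hv : v ∈ costableCore X Y e) :
    X.mulVec v ∈ costableCore X Y e := fun w => by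
  simpa [wordMat_append, wordMat_cons, wordMat, Matrix.mulVec_mulVec] using hv (w ++ [true])

lemma mulVec_right_mem_costableCore {v : Fin c → ℂ} (hv : v ∈ costableCore X Y e) :
    Y.mulVec v ∈ costableCore X Y e := fun w => by
  simpa [wordMat_append, wordMat_cons, wordMat, Matrix.mulVec_mulVec] using hv (w ++ [false])

lemma trace_mul_vecMulVec (M : Mat c) (g : Fin c → ℂ) :
    (M * vecMulVec g e).trace = e ⬝ᵥ M.mulVec g := by
  rw [Matrix.mul_vecMulVec, Matrix.trace_vecMulVec, dotProduct_comm]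

/-- For a rank one commutator `X * Y - Y * X = g e`, the vector `g` lies in the core. -/
lemma mem_costableCore_of_commutator {g : Fin c → ℂ} (h : X * Y - Y * X = vecMulVec g e) :
    g ∈ costableCore X Y e := fun w => by
  rw [← trace_mul_vecMulVec]
  refine trace_wordMat_mul_eq_zero h (fun P Q => ?_) w
  rw [mul_assoc P, mul_assoc P, Matrix.vecMulVec_mul, Matrix.vecMulVec_mul_vecMulVec,
    trace_mul_vecMulVec Q, Matrix.dotProduct_mulVec]
  simp [Matrix.vecMulVec_smul, mul_comm]

end Core

/-- Two matrices with `s • P + t • Q = 1` are affine in one matrix `X`, in independent ways. -/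
lemma exists_affine_param {c : ℕ} {P Q : Mat c} {s t : ℂ} (hc : 1 ≤ c)
    (h1 : s • P + t • Q = 1) :
    ∃ (X : Mat c) (a b a' b' : ℂ), a * b' - a' * b ≠ 0 ∧ P = a • 1 + b • X ∧
      Q = a' • 1 + b' • X := by
  by_cases ht : t = 0
  · have hs : s ≠ 0 := by
      rintro rfl
      have := congrFun (congrFun h1 ⟨0, hc⟩) ⟨0, hc⟩
      simp [ht] at this
    refine ⟨Q, s⁻¹, 0, 0, 1, by simpa using hs, ?_, by simp⟩
    rw [← h1, ht]
    simp [smul_smul, hs]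
  · refine ⟨P, 0, 1, t⁻¹, -(t⁻¹ * s), by simpa using ht, by simp, ?_⟩
    rw [← h1]
    simp [smul_smul, ht, smul_add]

/-- for `n ≥ 2`, under conditions (Q1), (Q2), (Q3) and (P2)
(regularity of the pencil `A₁ + λ A₂`), all the framing maps `f₁, …, f_{n-1}` vanish. -/
theorem stmt_13 (n c : ℕ) (hn : 2 ≤ n) (hc : 1 ≤ c) (A1 A2 : Mat c)
    (C : ℕ → Mat c) (e : Fin c → ℂ) (f : ℕ → Fin c → ℂ)
    (hQ1 : CondQ1 n c A1 A2 C e f) (hQ2 : CondQ2 n c A1 A2 C e)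
    (hQ3 : CondQ3 n c A1 A2 C f) (hP2 : CondP2 c A1 A2) :
    ∀ q : ℕ, 1 ≤ q → q ≤ n - 1 → f q = 0 := by
  obtain ⟨ν1, ν2, hν⟩ := hP2
  obtain ⟨m, rfl⟩ : ∃ m, n = m + 2 := ⟨n - 2, by omega⟩
  rw [CondQ1, if_neg (by omega)] at hQ1
  set D := ν1 • A1 + ν2 • A2 with hD
  have hu : IsUnit D.det := isUnit_iff_ne_zero.mpr hν
  set P := D⁻¹ * A1 with hP
  set Q := D⁻¹ * A2 with hQ
  have hDP : D * P = A1 := by rw [hP, Matrix.mul_nonsing_inv_cancel_left _ _ hu]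
  have hDQ : D * Q = A2 := by rw [hQ, Matrix.mul_nonsing_inv_cancel_left _ _ hu]
  have h1 : ν1 • P + ν2 • Q = 1 := by
    rw [hP, hQ, ← mul_smul_comm, ← mul_smul_comm, ← mul_add, ← hD, Matrix.nonsing_inv_mul _ hu]
  obtain ⟨X, a, b, a', b', hdet, hPX, hQX⟩ := exists_affine_param hc h1
  have hPQ : Commute P Q := by
    rw [hPX, hQX, commute_iff_eq]
    simp only [add_mul, mul_add, smul_mul_assoc, mul_smul_comm, one_mul, mul_one]
    module
  obtain ⟨E, hE⟩ := exists_eq_pow_mul_pow_mul h1 (m + 1) (fun q => C (q + 1) * D)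
    (fun q hq => by
      rw [hP, hQ, mul_assoc, mul_assoc, ← mul_assoc A1, ← mul_assoc A2,
        (hQ1 (q + 1) (by omega) (by omega)).1])
  have hf : ∀ q ≤ m, vecMulVec (f (q + 1)) e =
      P ^ q * Q ^ (m - q) * (P * E * Q - Q * E * P) := fun q hq => by
    have h := (hQ1 (q + 1) (by omega) (by omega)).2
    have e1 := hE q (by omega)
    have e2 := hE (q + 1) (by omega)
    rw [← hDP, ← hDQ, ← mul_assoc (C (q + 1)), ← mul_assoc (C (q + 1 + 1)), e1, e2,
      Nat.sub_add_comm hq, Nat.add_sub_add_right] at h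
    rw [eq_sub_of_add_eq' h, pow_succ P, pow_succ Q, mul_assoc (P ^ q) P, (hPQ.pow_right _).eq]
    noncomm_ring
  have hcomm : P * E * Q - Q * E * P = (a * b' - a' * b) • (E * X - X * E) := by
    rw [hPX, hQX]
    simp only [add_mul, mul_add, smul_mul_assoc, mul_smul_comm, one_mul, mul_one]
    module
  obtain ⟨g, hg⟩ : ∃ g, vecMulVec g e = P * E * Q - Q * E * P := by
    let L : (Fin c → ℂ) →ₗ[ℂ] Mat c :=
      { toFun := fun g => vecMulVec g e
        map_add' := fun x y => Matrix.add_vecMulVec x y e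
        map_smul' := fun r x => Matrix.smul_vecMulVec r x e }
    exact LinearMap.mem_range.mp (mem_of_pow_mul_pow_mul_mem hPQ h1 (LinearMap.range L) m _
      fun q hq => ⟨f (q + 1), hf q hq⟩)
  have hg' : E * X - X * E = vecMulVec ((a * b' - a' * b)⁻¹ • g) e := by
    rw [Matrix.smul_vecMulVec, hg, hcomm, smul_smul, inv_mul_cancel₀ hdet, one_smul]
  have hgW := mem_costableCore_of_commutator hg'
  set W := costableCore E X e with hW
  have hPW : ∀ v ∈ W, P.mulVec v ∈ W := fun v hv => by
    rw [hPX, Matrix.add_mulVec, Matrix.smul_mulVec, Matrix.smul_mulVec, Matrix.one_mulVec]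
    exact W.add_mem (W.smul_mem _ hv) (W.smul_mem _ (mulVec_right_mem_costableCore hv))
  have hQW : ∀ v ∈ W, Q.mulVec v ∈ W := fun v hv => by
    rw [hQX, Matrix.add_mulVec, Matrix.smul_mulVec, Matrix.smul_mulVec, Matrix.one_mulVec]
    exact W.add_mem (W.smul_mem _ hv) (W.smul_mem _ (mulVec_right_mem_costableCore hv))
  have hpow : ∀ M : Mat c, (∀ v ∈ W, M.mulVec v ∈ W) → ∀ k, ∀ v ∈ W, (M ^ k).mulVec v ∈ W := by
    intro M hM k
    induction k with
    | zero => intro v hv; simpa using hv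
    | succ k ih =>
      intro v hv
      rw [pow_succ, ← Matrix.mulVec_mulVec]
      exact ih _ (hM v hv)
  have hinj : Function.Injective D.mulVecLin :=
    Matrix.mulVec_injective_iff_isUnit.mpr ((Matrix.isUnit_iff_isUnit_det D).mpr hu)
  have hsub : SubRep (m + 2) c A1 A2 C W (W.map D.mulVecLin) := by
    refine ⟨fun v hv => ⟨⟨_, hPW v hv, ?_⟩, ⟨_, hQW v hv, ?_⟩⟩, ?_⟩
    · simp [hDP]
    · simp [hDQ]
    · rintro _ ⟨v, hv, rfl⟩ q hq hq'
      obtain ⟨q, rfl⟩ : ∃ k, q = k + 1 := ⟨q - 1, by omega⟩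
      have e1 := hE q (by omega)
      rw [Matrix.mulVecLin_apply, Matrix.mulVec_mulVec, e1, ← Matrix.mulVec_mulVec,
        ← Matrix.mulVec_mulVec]
      exact hpow P hPW _ _ (hpow Q hQW _ _ (mulVec_left_mem_costableCore hv))
  have hbot : W = ⊥ :=
    ((hQ2 _ _ hsub fun v hv => costableCore_le_ker hv).2
      (Submodule.equivMapOfInjective _ hinj W).finrank_eq).1
  rw [hbot, Submodule.mem_bot] at hgW
  rw [hgW, Matrix.zero_vecMulVec] at hg'
  have he : e ≠ 0 := by
    rintro rfl
    have hmem : (Pi.single ⟨0, hc⟩ 1 : Fin c → ℂ) ∈ W := fun w => by simp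
    rw [hbot, Submodule.mem_bot] at hmem
    simpa using congrFun hmem ⟨0, hc⟩
  intro q hq hq'
  obtain ⟨q, rfl⟩ : ∃ k, q = k + 1 := ⟨q - 1, by omega⟩
  have h0 := hf q (by omega)
  rw [hcomm, hg', smul_zero, mul_zero, Matrix.vecMulVec_eq_zero] at h0
  exact h0.resolve_right he
end
end
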